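/- arXiv:2507.05862 — 6 statements merged into one kernel-verified Lean document; each statement's English description precedes it below -/
import Mathlib

section
/- For every real number X ≥ 1 and every integer u > 1, one has | X·#{n ∈ ℕ : 1 ≤ n ≤ X, gcd(n,u) = 1} − Σ_{1 ≤ n ≤ X, gcd(n,u)=1} n − (φ(u)/(2u))·X² | ≤ σ(u)/8. -/
/-- Sum-of-divisors function `σ(u)`. -/
def sigmaFun (u : ℕ) : ℕ := ∑ d ∈ u.divisors, d


open ArithmeticFunction in
lemma moebius_sum_indicator (n : ℕ) (hn : n ≠ 0) :
    ∑ d ∈ n.divisors, ((moebius d : ℤ) : ℝ) = if n = 1 then 1 else 0 := by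
  have h := congrArg (fun f => f n) coe_zeta_mul_moebius
  simp only [coe_zeta_mul_apply, one_apply] at h
  exact_mod_cast h

open ArithmeticFunction in
lemma moebius_totient (u : ℕ) (hu : 0 < u) :
    ∑ d ∈ u.divisors, ((moebius d : ℤ) : ℝ) / d = (Nat.totient u : ℝ) / u := by
  have h := (sum_eq_iff_sum_mul_moebius_eq (R := ℝ) (f := fun n => (Nat.totient n : ℝ))
    (g := fun n => (n : ℝ))).1 (fun n _ => by exact_mod_cast Nat.sum_totient n) u hu
  rw [← h, Nat.sum_divisorsAntidiagonal (fun a b => ((moebius a : ℤ) : ℝ) * (b : ℝ)),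
    Finset.sum_div]
  refine Finset.sum_congr rfl fun d hd => ?_
  have hd' := Nat.dvd_of_mem_divisors hd
  have hd0 : (d : ℝ) ≠ 0 := by
    exact_mod_cast (Nat.pos_of_mem_divisors hd).ne'
  have hu0 : (u : ℝ) ≠ 0 := by exact_mod_cast hu.ne'
  rw [Nat.cast_div hd' hd0]
  field_simp

lemma sum_multiples (X : ℝ) (N d : ℕ) (hd : 0 < d) :
    ∑ n ∈ (Finset.Icc 1 N).filter (fun n => d ∣ n), (X - n)
      = ∑ m ∈ Finset.Icc 1 (N / d), (X - d * m) := by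
  symm
  refine Finset.sum_bij (fun m _ => d * m) ?_ ?_ ?_ ?_
  · intro m hm
    simp only [Finset.mem_Icc, Finset.mem_filter] at hm ⊢
    refine ⟨⟨Nat.mul_pos hd hm.1, ?_⟩, dvd_mul_right _ _⟩
    rw [mul_comm]
    exact (Nat.le_div_iff_mul_le hd).1 hm.2
  · intro a _ b _ h
    exact Nat.eq_of_mul_eq_mul_left hd h
  · intro n hn
    simp only [Finset.mem_Icc, Finset.mem_filter] at hn
    obtain ⟨⟨h1, h2⟩, m, rfl⟩ := hn
    refine ⟨m, ?_, rfl⟩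
    simp only [Finset.mem_Icc]
    refine ⟨Nat.pos_of_mul_pos_left h1, ?_⟩
    rw [Nat.le_div_iff_mul_le hd, mul_comm]
    exact h2
  · intro m _
    push_cast
    ring

lemma sum_linear (X d : ℝ) (k : ℕ) :
    ∑ m ∈ Finset.Icc 1 k, (X - d * m) = X * k - d * (k * (k + 1) / 2) := by
  induction k with
  | zero => simp
  | succ k ih =>
    rw [Finset.sum_Icc_succ_top (by omega), ih]
    push_cast
    ring

lemma inner_estimate (X : ℝ) (hX : 0 ≤ X) (d : ℕ) (hd : 0 < d) :
    |∑ n ∈ (Finset.Icc 1 ⌊X⌋₊).filter (fun n => d ∣ n), (X - n) - (X ^ 2 / (2 * d) - X / 2)|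
      ≤ (d : ℝ) / 8 := by
  have hd0 : (0 : ℝ) < d := by exact_mod_cast hd
  rw [sum_multiples X _ d hd, ← Nat.floor_div_natCast, sum_linear]
  have h0 : 0 ≤ X / d := by positivity
  have h1 := Nat.floor_le h0
  have h2 := Nat.lt_floor_add_one (X / d)
  generalize (⌊X / d⌋₊ : ℝ) = k at *
  obtain ⟨t, ht⟩ : ∃ t, t = X / d - k := ⟨_, rfl⟩
  have hXe : X = d * (k + t) := by rw [ht]; field_simp; ring
  have e : X * k - d * (k * (k + 1) / 2) - (X ^ 2 / (2 * d) - X / 2)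
      = d * (t * (1 - t) / 2) := by
    rw [hXe]; field_simp; ring
  have t0 : 0 ≤ t := by linarith
  have t1 : 0 ≤ 1 - t := by linarith
  rw [e, abs_of_nonneg (by positivity)]
  have : t * (1 - t) / 2 ≤ 1 / 8 := by nlinarith [sq_nonneg (t - 1 / 2)]
  nlinarith

open ArithmeticFunction in
lemma coprime_sum (X : ℝ) (N u : ℕ) (hu : 0 < u) :
    ∑ n ∈ (Finset.Icc 1 N).filter (fun n => Nat.Coprime n u), (X - n)
      = ∑ d ∈ u.divisors, ((moebius d : ℤ) : ℝ) *
          ∑ n ∈ (Finset.Icc 1 N).filter (fun n => d ∣ n), (X - n) := by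
  simp_rw [Finset.mul_sum, Finset.sum_filter]
  rw [Finset.sum_comm]
  refine Finset.sum_congr rfl fun n _ => ?_
  rw [← Finset.sum_filter, ← Finset.sum_mul]
  have hg : u.divisors.filter (fun d => d ∣ n) = (Nat.gcd n u).divisors := by
    ext d
    simp only [Finset.mem_filter, Nat.mem_divisors, Nat.dvd_gcd_iff]
    have : Nat.gcd n u ≠ 0 := (Nat.gcd_pos_of_pos_right n hu).ne'
    have := hu.ne'
    tauto
  rw [hg, moebius_sum_indicator _ (Nat.gcd_pos_of_pos_right n hu).ne']
  simp only [Nat.Coprime, ite_mul, one_mul, zero_mul]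

/-- For `X ≥ 1` and an integer `u > 1`,
`|X·#{1 ≤ n ≤ X : (n,u)=1} - Σ_{1 ≤ n ≤ X, (n,u)=1} n - (φ(u)/(2u))·X²| ≤ σ(u)/8`. -/
theorem coprime_count_sum_estimate (X : ℝ) (hX : 1 ≤ X) (u : ℕ) (hu : 1 < u) :
    |X * (((Finset.Icc 1 ⌊X⌋₊).filter (fun n => Nat.Coprime n u)).card : ℝ) -
        (∑ n ∈ (Finset.Icc 1 ⌊X⌋₊).filter (fun n => Nat.Coprime n u), (n : ℝ)) -
        (Nat.totient u : ℝ) / (2 * u) * X ^ 2| ≤ (sigmaFun u : ℝ) / 8 := by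
  have hu0 : 0 < u := by omega
  have h1 : X * (((Finset.Icc 1 ⌊X⌋₊).filter (fun n => Nat.Coprime n u)).card : ℝ) -
        (∑ n ∈ (Finset.Icc 1 ⌊X⌋₊).filter (fun n => Nat.Coprime n u), (n : ℝ))
      = ∑ n ∈ (Finset.Icc 1 ⌊X⌋₊).filter (fun n => Nat.Coprime n u), (X - n) := by
    rw [Finset.sum_sub_distrib, Finset.sum_const, nsmul_eq_mul, mul_comm]
  have h2 : (Nat.totient u : ℝ) / (2 * u) * X ^ 2
      = ∑ d ∈ u.divisors, ((ArithmeticFunction.moebius d : ℤ) : ℝ) *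
          (X ^ 2 / (2 * d) - X / 2) := by
    have a := moebius_totient u hu0
    have b := moebius_sum_indicator u hu0.ne'
    rw [if_neg hu.ne'] at b
    have c : (Nat.totient u : ℝ) / (2 * u) * X ^ 2
        = (Nat.totient u : ℝ) / u * (X ^ 2 / 2) - 0 * (X / 2) := by
      field_simp; ring
    rw [c, ← a, ← b, Finset.sum_mul, Finset.sum_mul, ← Finset.sum_sub_distrib]
    refine Finset.sum_congr rfl fun d hd => ?_
    field_simp
  rw [h1, h2, coprime_sum X _ u hu0, ← Finset.sum_sub_distrib, sigmaFun, Nat.cast_sum,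
    Finset.sum_div]
  refine (Finset.abs_sum_le_sum_abs _ _).trans (Finset.sum_le_sum fun d hd => ?_)
  rw [← mul_sub, abs_mul]
  have hm : |((ArithmeticFunction.moebius d : ℤ) : ℝ)| ≤ 1 := by
    exact_mod_cast ArithmeticFunction.abs_moebius_le_one (n := d)
  have hi := inner_estimate X (by linarith) d (Nat.pos_of_mem_divisors hd)
  calc _ ≤ 1 * ((d : ℝ) / 8) := mul_le_mul hm hi (abs_nonneg _) zero_le_one
    _ = _ := one_mul _
end

section
/- For every real number X ≥ 1 and every integer u > 1, one has | X·Σ_{1 ≤ q ≤ X, u‖q} φ(q)/q − Σ_{1 ≤ q ≤ X, u‖q} φ(q) − (3/(π²·u))·(∏_{p prime, p|u} (p−1)/(p+1))·X² | ≤ (φ(u)·X/(2u))·(σ(u)/4 + φ(u)/u + φ(u)/X), where q ranges over positive integers and the notation u‖q means u | q and gcd(q/u, u) = 1. -/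
open ArithmeticFunction in
lemma aux_sum_moebius (n : ℕ) :
    ∑ d ∈ n.divisors, (moebius d : ℝ) = if n = 1 then 1 else 0 := by
  have h : (moebius * (zeta : ArithmeticFunction ℤ)) n = (1 : ArithmeticFunction ℤ) n := by
    rw [moebius_mul_coe_zeta]
  rw [coe_mul_zeta_apply, one_apply] at h
  have := congrArg (Int.cast : ℤ → ℝ) h
  push_cast at this
  exact this

open ArithmeticFunction in
lemma aux_coprime (k u : ℕ) (hu : 0 < u) :
    (if Nat.Coprime k u then (1:ℝ) else 0)
      = ∑ e ∈ u.divisors, if e ∣ k then (moebius e : ℝ) else 0 := by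
  rw [← Finset.sum_filter]
  have : u.divisors.filter (fun e => e ∣ k) = (Nat.gcd k u).divisors := by
    ext e
    have : Nat.gcd k u ≠ 0 := (Nat.gcd_pos_of_pos_right _ hu).ne'
    simp only [Finset.mem_filter, Nat.mem_divisors, Nat.dvd_gcd_iff]
    constructor
    · rintro ⟨⟨h1, _⟩, h2⟩
      exact ⟨⟨h2, h1⟩, this⟩
    · rintro ⟨⟨h2, h1⟩, _⟩
      exact ⟨⟨h1, hu.ne'⟩, h2⟩
  rw [this, aux_sum_moebius]

open ArithmeticFunction in
lemma aux_totient (m : ℕ) (hm : 0 < m) :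
    (Nat.totient m : ℝ) / m = ∑ d ∈ m.divisors, (moebius d : ℝ) / d := by
  have h := (sum_eq_iff_sum_mul_moebius_eq (R := ℝ) (f := fun n => (Nat.totient n : ℝ))
    (g := fun n => (n : ℝ))).1 (by
      intro n _
      exact_mod_cast Nat.sum_totient n) m hm
  have hm' : (m : ℝ) ≠ 0 := by positivity
  rw [← h, Finset.sum_div, Nat.sum_divisorsAntidiagonal
    (f := fun a b => (moebius a : ℝ) * (b : ℝ) / m)]
  refine Finset.sum_congr rfl fun d hd => ?_
  have hdm := Nat.dvd_of_mem_divisors hd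
  have hd0 : (d : ℝ) ≠ 0 := by
    exact_mod_cast (Nat.pos_of_mem_divisors hd).ne'
  rw [Nat.cast_div hdm hd0]
  field_simp

lemma aux_reindex (n e : ℕ) (he : 0 < e) (h : ℕ → ℝ) :
    ∑ k ∈ Finset.Icc 1 n, (if e ∣ k then h k else 0)
      = ∑ j ∈ Finset.Icc 1 (n / e), h (e * j) := by
  rw [← Finset.sum_filter]
  symm
  refine Finset.sum_bij (fun j _ => e * j) ?_ ?_ ?_ ?_
  · intro j hj
    simp only [Finset.mem_Icc, Finset.mem_filter] at hj ⊢
    refine ⟨⟨Nat.mul_pos he hj.1, ?_⟩, dvd_mul_right _ _⟩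
    rw [mul_comm]
    exact (Nat.le_div_iff_mul_le he).1 hj.2
  · intro a _ b _ hab
    exact Nat.eq_of_mul_eq_mul_left he hab
  · intro k hk
    simp only [Finset.mem_Icc, Finset.mem_filter] at hk
    obtain ⟨⟨h1, h2⟩, j, rfl⟩ := hk
    refine ⟨j, ?_, rfl⟩
    simp only [Finset.mem_Icc]
    refine ⟨Nat.pos_of_ne_zero fun h => by simp [h] at h1, ?_⟩
    rw [Nat.le_div_iff_mul_le he, mul_comm]
    exact h2
  · intros; rfl

lemma aux_arith (n : ℕ) (W : ℝ) :
    ∑ j ∈ Finset.Icc 1 n, (W - j) = n * W - n * (n + 1) / 2 := by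
  induction n with
  | zero => simp
  | succ k ih => rw [Finset.sum_Icc_succ_top (by omega), ih]; push_cast; ring

lemma aux_frac (W : ℝ) (hW : 0 ≤ W) :
    |∑ j ∈ Finset.Icc 1 ⌊W⌋₊, (W - j) - (W ^ 2 / 2 - W / 2)| ≤ 1 / 8 := by
  rw [aux_arith]
  have h1 := Nat.floor_le hW
  have h2 := Nat.lt_floor_add_one W
  set n : ℝ := (⌊W⌋₊ : ℝ)
  rw [abs_le]
  constructor
  · nlinarith [mul_nonneg (sub_nonneg.2 h1) (sub_nonneg.2 h2.le)]
  · nlinarith [sq_nonneg (W - n - 1 / 2)]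

noncomputable def auxG (u : ℕ) (Z : ℝ) : ℝ :=
  ∑ k ∈ Finset.Icc 1 ⌊Z⌋₊, if Nat.Coprime k u then Z - k else 0

open ArithmeticFunction in
lemma auxG_eq (u : ℕ) (hu : 0 < u) (Z : ℝ) :
    auxG u Z = ∑ e ∈ u.divisors, (moebius e : ℝ) * e *
      ∑ j ∈ Finset.Icc 1 ⌊Z / e⌋₊, (Z / e - j) := by
  have h1 : auxG u Z = ∑ k ∈ Finset.Icc 1 ⌊Z⌋₊, ∑ e ∈ u.divisors,
      if e ∣ k then (moebius e : ℝ) * (Z - k) else 0 := by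
    refine Finset.sum_congr rfl fun k _ => ?_
    have := congrArg (· * (Z - k)) (aux_coprime k u hu)
    simpa [Finset.sum_mul, ite_mul] using this
  rw [h1, Finset.sum_comm]
  refine Finset.sum_congr rfl fun e he => ?_
  have he0 := Nat.pos_of_mem_divisors he
  have he1 : (e : ℝ) ≠ 0 := by exact_mod_cast he0.ne'
  rw [aux_reindex _ e he0, Nat.floor_div_natCast, Finset.mul_sum]
  refine Finset.sum_congr rfl fun j _ => ?_
  push_cast
  field_simp

open ArithmeticFunction in
lemma auxG_bound (u : ℕ) (hu : 1 < u) (Z : ℝ) (hZ : 0 ≤ Z) :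
    |auxG u Z - (Nat.totient u : ℝ) / u * (Z ^ 2 / 2)| ≤ (∑ d ∈ u.divisors, (d : ℝ)) / 8 := by
  have hm : (Nat.totient u : ℝ) / u * (Z ^ 2 / 2) = ∑ e ∈ u.divisors, (moebius e : ℝ) * e *
      ((Z / e) ^ 2 / 2 - Z / e / 2) := by
    have h0 := aux_sum_moebius u
    rw [if_neg hu.ne'] at h0
    have : ∑ e ∈ u.divisors, (moebius e : ℝ) * e * ((Z / e) ^ 2 / 2 - Z / e / 2) =
        ∑ e ∈ u.divisors, ((moebius e : ℝ) / e * (Z ^ 2 / 2) - (moebius e : ℝ) * (Z / 2)) := by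
      refine Finset.sum_congr rfl fun e he => ?_
      have he1 : (e : ℝ) ≠ 0 := by exact_mod_cast (Nat.pos_of_mem_divisors he).ne'
      field_simp
    rw [this, Finset.sum_sub_distrib, ← Finset.sum_mul, ← Finset.sum_mul, h0,
      aux_totient u (by omega)]
    ring
  rw [auxG_eq u (by omega), hm, ← Finset.sum_sub_distrib, Finset.sum_div]
  refine (Finset.abs_sum_le_sum_abs _ _).trans (Finset.sum_le_sum fun e he => ?_)
  rw [← mul_sub, abs_mul, abs_mul, Nat.abs_cast]
  have h1 : |(moebius e : ℝ)| ≤ 1 := by exact_mod_cast abs_moebius_le_one (n := e)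
  have h2 := aux_frac (Z / e) (by positivity)
  calc _ ≤ 1 * (e : ℝ) * (1 / 8) := by gcongr
    _ = _ := by ring

open ArithmeticFunction in
lemma aux_conv (u : ℕ) (Y : ℝ) :
    ∑ m ∈ Finset.Icc 1 ⌊Y⌋₊, (if Nat.Coprime m u then (Nat.totient m : ℝ) / m * (Y - m) else 0)
     = ∑ d ∈ Finset.Icc 1 ⌊Y⌋₊, if Nat.Coprime d u then (moebius d : ℝ) * auxG u (Y / d) else 0 := by
  have h1 : ∀ m ∈ Finset.Icc 1 ⌊Y⌋₊,
      (if Nat.Coprime m u then (Nat.totient m : ℝ) / m * (Y - m) else 0) =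
      ∑ d ∈ Finset.Icc 1 ⌊Y⌋₊, if d ∣ m then
        (if Nat.Coprime m u then (moebius d : ℝ) / d * (Y - m) else 0) else 0 := by
    intro m hm
    rw [Finset.mem_Icc] at hm
    split_ifs with hc
    · rw [← Finset.sum_filter, aux_totient m (by omega), Finset.sum_mul]
      refine Finset.sum_congr ?_ fun _ _ => rfl
      ext d
      simp only [Nat.mem_divisors, Finset.mem_filter, Finset.mem_Icc]
      constructor
      · rintro ⟨h, h'⟩
        exact ⟨⟨Nat.pos_of_dvd_of_pos h (by omega), (Nat.le_of_dvd (by omega) h).trans hm.2⟩, h⟩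
      · rintro ⟨_, h⟩
        exact ⟨h, by omega⟩
    · simp
  rw [Finset.sum_congr rfl h1, Finset.sum_comm]
  refine Finset.sum_congr rfl fun d hd => ?_
  rw [Finset.mem_Icc] at hd
  have hd1 : (d : ℝ) ≠ 0 := by
    have : d ≠ 0 := by omega
    exact_mod_cast this
  rw [aux_reindex _ d (by omega) (fun m =>
    if Nat.Coprime m u then (moebius d : ℝ) / d * (Y - m) else 0), auxG, Nat.floor_div_natCast]
  by_cases hc : Nat.Coprime d u
  · rw [if_pos hc, Finset.mul_sum]
    refine Finset.sum_congr rfl fun j _ => ?_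
    by_cases hj : Nat.Coprime j u
    · have hdj : Nat.Coprime (d * j) u := Nat.coprime_mul_iff_left.2 ⟨hc, hj⟩
      rw [if_pos hj, if_pos hdj]
      push_cast; field_simp
    · have hdj : ¬ Nat.Coprime (d * j) u := fun h => hj (Nat.coprime_mul_iff_left.1 h).2
      rw [if_neg hj, if_neg hdj, mul_zero]
  · simp [Nat.coprime_mul_iff_left, hc]

noncomputable def auxf (u d : ℕ) : ℝ :=
  if Nat.Coprime d u then (ArithmeticFunction.moebius d : ℝ) / (d : ℝ) ^ 2 else 0

lemma auxf_abs (u d : ℕ) : |auxf u d| ≤ 1 / (d : ℝ) ^ 2 := by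
  unfold auxf
  split_ifs
  · rw [abs_div, abs_of_nonneg (by positivity : (0:ℝ) ≤ (d : ℝ) ^ 2)]
    have h1 : |(ArithmeticFunction.moebius d : ℝ)| ≤ 1 := by
      exact_mod_cast ArithmeticFunction.abs_moebius_le_one (n := d)
    gcongr
  · simp

lemma auxf_hasSum (u : ℕ) (hu : 1 < u) :
    HasSum (auxf u) (6 / Real.pi ^ 2 * (∏ p ∈ u.primeFactors, (1 - ((p : ℝ) ^ 2)⁻¹))⁻¹) := by
  have : NeZero u := ⟨by omega⟩
  have hs : 1 < (2 : ℂ).re := by norm_num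
  have h1 := DirichletCharacter.LSeries.mul_mu_eq_one (1 : DirichletCharacter ℂ u) hs
  have hsum := DirichletCharacter.LSeriesSummable_mul (1 : DirichletCharacter ℂ u) <|
    ArithmeticFunction.LSeriesSummable_moebius_iff.mpr hs
  have h2 := DirichletCharacter.LFunctionTrivChar_eq_mul_riemannZeta (N := u)
    (s := 2) (by norm_num)
  rw [DirichletCharacter.LFunctionTrivChar, DirichletCharacter.LFunction_eq_LSeries _ hs,
    riemannZeta_two] at h2
  rw [h2] at h1
  have h3 := hsum.LSeriesHasSum
  rw [LSeriesHasSum, eq_inv_of_mul_eq_one_right h1] at h3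
  rw [← Complex.hasSum_ofReal]
  convert h3 using 1
  · funext d
    rcases Nat.eq_zero_or_pos d with rfl | hd
    · simp [auxf]
    · rw [LSeries.term_of_ne_zero hd.ne']
      by_cases hc : Nat.Coprime d u
      · have : IsUnit (d : ZMod u) := (ZMod.isUnit_iff_coprime d u).2 hc
        rw [auxf, if_pos hc]
        simp [MulChar.one_apply this]
      · have : ¬ IsUnit (d : ZMod u) := fun h => hc ((ZMod.isUnit_iff_coprime d u).1 h)
        simp [auxf, hc, MulChar.map_nonunit _ this]
  · push_cast
    rw [mul_inv, mul_comm]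
    congr 1
    · congr 1
      refine Finset.prod_congr rfl fun p _ => ?_
      rw [Complex.cpow_neg]
      simp
    · simp

lemma aux_tail (u : ℕ) (S : ℝ) (h : HasSum (auxf u) S) (N : ℕ) :
    |∑ d ∈ Finset.Icc 1 N, auxf u d - S| ≤ 1 / ((N : ℝ) + 1) ^ 2 + 1 / ((N : ℝ) + 1) := by
  have key : ∀ k : ℕ, |∑ d ∈ Finset.Icc 1 N, auxf u d - ∑ d ∈ Finset.Icc 1 (N + 1 + k), auxf u d|
      ≤ 1 / ((N : ℝ) + 1) ^ 2 + 1 / ((N : ℝ) + 1) - 1 / ((N : ℝ) + 1 + k) := by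
    intro k
    induction k with
    | zero =>
      rw [add_zero, Finset.sum_Icc_succ_top (by omega)]
      have := auxf_abs u (N + 1)
      push_cast at this
      simpa using this
    | succ k ih =>
      rw [← add_assoc, Finset.sum_Icc_succ_top (by omega), ← sub_sub]
      refine (abs_sub _ _).trans ?_
      have := auxf_abs u (N + 1 + k + 1)
      push_cast at this ⊢
      have h3 : 1 / ((N : ℝ) + 1 + k + 1) ^ 2 ≤
          1 / ((N : ℝ) + 1 + k) - 1 / ((N : ℝ) + 1 + k + 1) := by
        rw [div_sub_div _ _ (by positivity) (by positivity), div_le_div_iff₀ (by positivity) (by positivity)]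
        have : (0:ℝ) ≤ (N : ℝ) + 1 + k := by positivity
        nlinarith
      rw [← add_assoc ((N : ℝ) + 1)]
      linarith
  have ht := h.tendsto_sum_nat
  have h0 : auxf u 0 = 0 := by simp [auxf]
  have ht2 : Filter.Tendsto (fun k => ∑ d ∈ Finset.Icc 1 (N + 1 + k), auxf u d) Filter.atTop
      (nhds S) := by
    have : (fun k => ∑ d ∈ Finset.Icc 1 (N + 1 + k), auxf u d) =
        fun k => ∑ d ∈ Finset.range (k + (N + 2)), auxf u d := by
      funext k
      rw [Finset.range_eq_Ico, Finset.sum_eq_sum_Ico_succ_bot (by omega), h0, zero_add]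
      refine Finset.sum_congr ?_ fun _ _ => rfl
      ext x
      simp only [Finset.mem_Icc, Finset.mem_Ico]
      omega
    rw [this]
    exact (Filter.tendsto_add_atTop_iff_nat (f := fun n => ∑ d ∈ Finset.range n, auxf u d)
      (N + 2)).2 ht
  refine le_of_tendsto ((tendsto_const_nhds.sub ht2).abs) (Filter.Eventually.of_forall fun k => ?_)
  refine (key k).trans ?_
  have : (0:ℝ) ≤ 1 / ((N : ℝ) + 1 + k) := by positivity
  linarith

/-- The main estimate in terms of `Y = X / u`. -/
lemma aux_main (u : ℕ) (hu : 1 < u) (Y : ℝ) (hY : 0 < Y) (S : ℝ) (h : HasSum (auxf u) S) :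
    |∑ m ∈ Finset.Icc 1 ⌊Y⌋₊, (if Nat.Coprime m u then (Nat.totient m : ℝ) / m * (Y - m) else 0)
      - (Nat.totient u : ℝ) / u * (Y ^ 2 / 2) * S| ≤
      Y * ((∑ d ∈ u.divisors, (d : ℝ)) / 8) + (Nat.totient u : ℝ) / u * (Y + 1) / 2 := by
  set σ : ℝ := (∑ d ∈ u.divisors, (d : ℝ)) / 8
  set c : ℝ := (Nat.totient u : ℝ) / u
  have hc : 0 ≤ c := by positivity
  have hσ : 0 ≤ σ := by positivity
  have e1 : |∑ d ∈ Finset.Icc 1 ⌊Y⌋₊,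
      (if Nat.Coprime d u then (ArithmeticFunction.moebius d : ℝ) * auxG u (Y / d) else 0)
      - c * (Y ^ 2 / 2) * ∑ d ∈ Finset.Icc 1 ⌊Y⌋₊, auxf u d| ≤ Y * σ := by
    rw [Finset.mul_sum, ← Finset.sum_sub_distrib]
    refine (Finset.abs_sum_le_sum_abs _ _).trans ?_
    have : ∀ d ∈ Finset.Icc 1 ⌊Y⌋₊,
      |(if Nat.Coprime d u then (ArithmeticFunction.moebius d : ℝ) * auxG u (Y / d) else 0)
      - c * (Y ^ 2 / 2) * auxf u d| ≤ σ := by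
      intro d hd
      unfold auxf
      split_ifs
      · have h1 : |(ArithmeticFunction.moebius d : ℝ)| ≤ 1 := by
          exact_mod_cast ArithmeticFunction.abs_moebius_le_one (n := d)
        have h2 := auxG_bound u hu (Y / d) (by positivity)
        have : (ArithmeticFunction.moebius d : ℝ) * auxG u (Y / d) -
          c * (Y ^ 2 / 2) * ((ArithmeticFunction.moebius d : ℝ) / (d : ℝ) ^ 2) =
          (ArithmeticFunction.moebius d : ℝ) * (auxG u (Y / d) - c * ((Y / d) ^ 2 / 2)) := by
          rw [div_pow]; ring
        rw [this, abs_mul]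
        calc _ ≤ 1 * σ := by gcongr
          _ = σ := one_mul _
      · simpa using hσ
    refine (Finset.sum_le_sum this).trans ?_
    rw [Finset.sum_const, Nat.card_Icc, nsmul_eq_mul, Nat.add_sub_cancel]
    gcongr
    exact Nat.floor_le hY.le
  have e2 := aux_tail u S h ⌊Y⌋₊
  have e3 : 1 / ((⌊Y⌋₊ : ℝ) + 1) ^ 2 + 1 / ((⌊Y⌋₊ : ℝ) + 1) ≤ 1 / Y ^ 2 + 1 / Y := by
    have := (Nat.lt_floor_add_one Y).le
    gcongr
  have e4 : |c * (Y ^ 2 / 2) * ∑ d ∈ Finset.Icc 1 ⌊Y⌋₊, auxf u d - c * (Y ^ 2 / 2) * S| ≤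
      c * (Y + 1) / 2 := by
    rw [← mul_sub, abs_mul, abs_of_nonneg (by positivity : 0 ≤ c * (Y ^ 2 / 2))]
    calc _ ≤ c * (Y ^ 2 / 2) * (1 / Y ^ 2 + 1 / Y) := by gcongr; exact e2.trans e3
      _ = _ := by field_simp; ring
  rw [aux_conv]
  exact (abs_sub_le _ _ _).trans (add_le_add e1 e4)

lemma aux_lhs (X : ℝ) (u : ℕ) (hu : 1 < u) :
    X * (∑ q ∈ (Finset.Icc 1 ⌊X⌋₊).filter (fun q => u ∣ q ∧ Nat.Coprime (q / u) u),
            (Nat.totient q : ℝ) / q) -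
        (∑ q ∈ (Finset.Icc 1 ⌊X⌋₊).filter (fun q => u ∣ q ∧ Nat.Coprime (q / u) u),
            (Nat.totient q : ℝ)) =
    (Nat.totient u : ℝ) * ∑ m ∈ Finset.Icc 1 ⌊X / u⌋₊,
      (if Nat.Coprime m u then (Nat.totient m : ℝ) / m * (X / u - m) else 0) := by
  have hu0 : (u : ℝ) ≠ 0 := by
    have : u ≠ 0 := by omega
    exact_mod_cast this
  rw [Finset.mul_sum, ← Finset.sum_sub_distrib, Finset.sum_filter]
  simp only [ite_and]
  rw [aux_reindex _ u (by omega) (fun q => if Nat.Coprime (q / u) u then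
    X * ((Nat.totient q : ℝ) / q) - (Nat.totient q : ℝ) else 0), Nat.floor_div_natCast,
    Finset.mul_sum]
  refine Finset.sum_congr rfl fun m hm => ?_
  rw [Finset.mem_Icc] at hm
  rw [Nat.mul_div_cancel_left m (by omega)]
  have hm0 : (m : ℝ) ≠ 0 := by
    have : m ≠ 0 := by omega
    exact_mod_cast this
  split_ifs with hc
  · rw [Nat.totient_mul hc.symm]
    push_cast
    field_simp
  · simp

lemma aux_const (u : ℕ) (hu : 1 < u) (X : ℝ) :
    3 / (Real.pi ^ 2 * u) * (∏ p ∈ u.primeFactors, ((p : ℝ) - 1) / ((p : ℝ) + 1)) * X ^ 2 =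
    (Nat.totient u : ℝ) * ((Nat.totient u : ℝ) / u * ((X / u) ^ 2 / 2) *
      (6 / Real.pi ^ 2 * (∏ p ∈ u.primeFactors, (1 - ((p : ℝ) ^ 2)⁻¹))⁻¹)) := by
  have hu0 : (u : ℝ) ≠ 0 := by
    have : u ≠ 0 := by omega
    exact_mod_cast this
  have ht : (Nat.totient u : ℝ) = u * ∏ p ∈ u.primeFactors, (1 - (p : ℝ)⁻¹) := by
    have := congrArg (Rat.cast : ℚ → ℝ) (Nat.totient_eq_mul_prod_factors u)
    push_cast at this
    exact this
  have hp : (∏ p ∈ u.primeFactors, ((p : ℝ) - 1) / ((p : ℝ) + 1)) =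
      (∏ p ∈ u.primeFactors, (1 - (p : ℝ)⁻¹)) ^ 2 *
        (∏ p ∈ u.primeFactors, (1 - ((p : ℝ) ^ 2)⁻¹))⁻¹ := by
    rw [← Finset.prod_inv_distrib, ← Finset.prod_pow, ← Finset.prod_mul_distrib]
    refine Finset.prod_congr rfl fun p hp => ?_
    have hp2 : (2 : ℝ) ≤ p := by exact_mod_cast (Nat.prime_of_mem_primeFactors hp).two_le
    have h1 : (p : ℝ) - 1 ≠ 0 := by linarith
    have h2 : (p : ℝ) + 1 ≠ 0 := by linarith
    have h3 : (p : ℝ) ≠ 0 := by linarith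
    have h4 : 1 - ((p : ℝ) ^ 2)⁻¹ = ((p : ℝ) - 1) * (p + 1) / p ^ 2 := by field_simp; ring
    have h5 : 1 - (p : ℝ)⁻¹ = ((p : ℝ) - 1) / p := by field_simp
    rw [h4, h5]
    field_simp
  rw [hp, ht]
  have := Real.pi_ne_zero
  field_simp
  ring

theorem totient_weighted_sum_estimate (X : ℝ) (hX : 1 ≤ X) (u : ℕ) (hu : 1 < u) :
    |X * (∑ q ∈ (Finset.Icc 1 ⌊X⌋₊).filter (fun q => u ∣ q ∧ Nat.Coprime (q / u) u),
            (Nat.totient q : ℝ) / q) -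
        (∑ q ∈ (Finset.Icc 1 ⌊X⌋₊).filter (fun q => u ∣ q ∧ Nat.Coprime (q / u) u),
            (Nat.totient q : ℝ)) -
        3 / (Real.pi ^ 2 * u) * (∏ p ∈ u.primeFactors, ((p : ℝ) - 1) / ((p : ℝ) + 1)) * X ^ 2|
      ≤ (Nat.totient u : ℝ) * X / (2 * u) *
          ((sigmaFun u : ℝ) / 4 + (Nat.totient u : ℝ) / u + (Nat.totient u : ℝ) / X) := by
  have hu0 : (0 : ℝ) < u := by
    have : 0 < u := by omega
    exact_mod_cast this
  have hX0 : 0 < X := by linarith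
  have h := aux_main u hu (X / u) (by positivity) _ (auxf_hasSum u hu)
  rw [aux_lhs X u hu, aux_const u hu X, ← mul_sub, abs_mul, Nat.abs_cast]
  refine (mul_le_mul_of_nonneg_left h (Nat.cast_nonneg _)).trans (le_of_eq ?_)
  have hs : (sigmaFun u : ℝ) = ∑ d ∈ u.divisors, (d : ℝ) := by simp [sigmaFun]
  rw [hs]
  field_simp
  ring
end

section
/- Let f be a prime, let h be a positive integer, let u > 1 be a product of pairwise distinct primes, let H ∈ (0,f) be real, and set X = H/h; suppose X/u ≥ 1. Define N_u(X) = Σ_{0 ≤ t < q ≤ X, gcd(t,q)=1, u‖q} ( #{z ∈ ℤ : z ∈ I(q,t)} + #{z ∈ ℤ : z ∈ J(q,t)} ), where u‖q means u | q and gcd(q/u, u) = 1. Then N_u(X) ≥ E_u(X)·(6/π²)·(1/u)·(φ(u)/σ(u))·X²·h. -/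
/-- The quantity `E_u(X) = 1 - (π²/6)·σ(u)·(σ(u)/4 + φ(u)/u + φ(u)/X)/X`. -/
noncomputable def EFun (u : ℕ) (X : ℝ) : ℝ :=
  1 - (Real.pi ^ 2 / 6) * (sigmaFun u : ℝ) *
    ((sigmaFun u : ℝ) / 4 + (Nat.totient u : ℝ) / u + (Nat.totient u : ℝ) / X) / X

/-- The number of integers in the half-open real interval `(a, b]`. -/
noncomputable def countIoc (a b : ℝ) : ℕ := Nat.card {z : ℤ // a < (z : ℝ) ∧ (z : ℝ) ≤ b}

/-- The number of integers in the half-open real interval `[a, b)`. -/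
noncomputable def countIco (a b : ℝ) : ℕ := Nat.card {z : ℤ // a ≤ (z : ℝ) ∧ (z : ℝ) < b}


lemma countIoc_ge (a b : ℝ) : b - a - 1 ≤ (countIoc a b : ℝ) := by
  have h1 : countIoc a b = (⌊b⌋ - ⌊a⌋).toNat := by
    unfold countIoc
    rw [← Int.card_Ioc, ← Nat.card_eq_finsetCard]
    apply Nat.card_congr
    apply Equiv.subtypeEquivRight
    intro z
    rw [Finset.mem_Ioc, Int.floor_lt, Int.le_floor]
  have h2 : (⌊b⌋ - ⌊a⌋ : ℤ) ≤ ((⌊b⌋ - ⌊a⌋).toNat : ℤ) := Int.self_le_toNat _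
  have h3 : ((⌊b⌋ - ⌊a⌋ : ℤ) : ℝ) ≤ (((⌊b⌋ - ⌊a⌋).toNat : ℤ) : ℝ) := by exact_mod_cast h2
  rw [h1]
  push_cast at h3
  have := Int.sub_one_lt_floor b
  have := Int.floor_le a
  push_cast
  linarith

lemma countIco_ge (a b : ℝ) : b - a - 1 ≤ (countIco a b : ℝ) := by
  have h1 : countIco a b = (⌈b⌉ - ⌈a⌉).toNat := by
    unfold countIco
    rw [← Int.card_Ico, ← Nat.card_eq_finsetCard]
    apply Nat.card_congr
    apply Equiv.subtypeEquivRight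
    intro z
    rw [Finset.mem_Ico, Int.lt_ceil, Int.ceil_le]
  have h2 : (⌈b⌉ - ⌈a⌉ : ℤ) ≤ ((⌈b⌉ - ⌈a⌉).toNat : ℤ) := Int.self_le_toNat _
  have h3 : ((⌈b⌉ - ⌈a⌉ : ℤ) : ℝ) ≤ (((⌈b⌉ - ⌈a⌉).toNat : ℤ) : ℝ) := by exact_mod_cast h2
  rw [h1]
  push_cast at h3
  have := Int.ceil_lt_add_one a
  have := Int.le_ceil b
  push_cast
  linarith

/-- triangular sums: `∑_{k ≤ y} (y - k)`. -/
lemma tri_bound (y : ℝ) (hy : 0 ≤ y) :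
    |2 * ∑ k ∈ Finset.Ioc 0 ⌊y⌋₊, (y - k) - (y ^ 2 - y) - 1 / 8| ≤ 1 / 8 := by
  have key : ∀ n : ℕ, 2 * ∑ k ∈ Finset.Ioc 0 n, (y - k) = 2 * n * y - n * (n + 1) := by
    intro n
    induction n with
    | zero => simp
    | succ n ih =>
      rw [Finset.sum_Ioc_succ_top (Nat.zero_le n), mul_add, ih]
      push_cast
      ring
  rw [key, abs_le]
  have h1 := Nat.floor_le hy
  have h2 := Nat.lt_floor_add_one y
  constructor <;> nlinarith [sq_nonneg (y - ⌊y⌋₊ - 1 / 2)]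

open ArithmeticFunction in
lemma sum_moebius_div (u : ℕ) (hu : 0 < u) :
    ∑ e ∈ u.divisors, (moebius e : ℝ) / e = (u.totient : ℝ) / u := by
  have := (sum_eq_iff_sum_mul_moebius_eq (R := ℝ) (f := fun n => (n.totient : ℝ))
    (g := fun n => (n : ℝ))).1 (fun n _ => by exact_mod_cast Nat.sum_totient n) u hu
  rw [← this, Finset.sum_div, Nat.sum_divisorsAntidiagonal (fun a b => (moebius a : ℝ) * b / u)]
  apply Finset.sum_congr rfl
  intro e he
  have hd := Nat.dvd_of_mem_divisors he
  have : (e : ℝ) ≠ 0 := by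
    have := Nat.pos_of_mem_divisors he
    positivity
  have : (u : ℝ) ≠ 0 := by positivity
  rw [Nat.cast_div hd ‹_›]
  field_simp

open ArithmeticFunction in
lemma sum_moebius_divisors (u : ℕ) (hu : 0 < u) :
    ∑ e ∈ u.divisors, (moebius e : ℝ) = if u = 1 then 1 else 0 := by
  have : (∑ e ∈ u.divisors, moebius e) = if u = 1 then 1 else 0 := by
    rw [← coe_mul_zeta_apply, moebius_mul_coe_zeta, one_apply]
  exact_mod_cast congrArg (Int.cast (R := ℝ)) this

open ArithmeticFunction in
lemma coprime_ind (u k : ℕ) (hu : 0 < u) :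
    (if Nat.Coprime k u then (1 : ℝ) else 0) =
      ∑ e ∈ u.divisors, if e ∣ k then (moebius e : ℝ) else 0 := by
  rw [← Finset.sum_filter]
  have : u.divisors.filter (fun e => e ∣ k) = (Nat.gcd k u).divisors := by
    ext e
    simp only [Finset.mem_filter, Nat.mem_divisors, Nat.dvd_gcd_iff]
    have : Nat.gcd k u ≠ 0 := (Nat.gcd_pos_of_pos_right k hu).ne'
    constructor
    · rintro ⟨⟨h1, h2⟩, h3⟩; exact ⟨⟨h3, h1⟩, this⟩
    · rintro ⟨⟨h1, h2⟩, h3⟩; exact ⟨⟨h2, hu.ne'⟩, h1⟩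
  rw [this, sum_moebius_divisors _ (Nat.gcd_pos_of_pos_right k hu)]

lemma sum_mult (y : ℝ) (e : ℕ) (he : 0 < e) :
    ∑ k ∈ Finset.Ioc 0 ⌊y⌋₊, (if e ∣ k then (y - k) else 0) =
      e * ∑ k ∈ Finset.Ioc 0 ⌊y / e⌋₊, (y / e - k) := by
  have he' : (e : ℝ) ≠ 0 := by positivity
  rw [← Finset.sum_filter, Finset.mul_sum]
  symm
  apply Finset.sum_bij (fun k _ => e * k)
  · intro k hk
    simp only [Finset.mem_Ioc, Finset.mem_filter] at hk ⊢
    rw [Nat.floor_div_natCast, Nat.le_div_iff_mul_le he] at hk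
    exact ⟨⟨Nat.mul_pos he hk.1, by linarith [hk.2]⟩, dvd_mul_right _ _⟩
  · intro a _ b _ hab
    exact Nat.eq_of_mul_eq_mul_left he hab
  · intro b hb
    simp only [Finset.mem_Ioc, Finset.mem_filter] at hb
    obtain ⟨⟨h1, h2⟩, c, rfl⟩ := hb
    refine ⟨c, ?_, rfl⟩
    rw [Finset.mem_Ioc, Nat.floor_div_natCast, Nat.le_div_iff_mul_le he]
    exact ⟨Nat.pos_of_mul_pos_left h1, by linarith⟩
  · intro k _
    push_cast
    field_simp

open ArithmeticFunction in
lemma G_bound (u : ℕ) (hu : 1 < u) (y : ℝ) (hy : 0 ≤ y) :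
    |2 * ∑ k ∈ Finset.Ioc 0 ⌊y⌋₊, (if Nat.Coprime k u then (y - k) else 0)
      - (u.totient : ℝ) / u * y ^ 2| ≤ (sigmaFun u : ℝ) / 4 := by
  have hu0 : 0 < u := by omega
  have h1 : ∑ k ∈ Finset.Ioc 0 ⌊y⌋₊, (if Nat.Coprime k u then (y - k) else 0) =
      ∑ e ∈ u.divisors, (moebius e : ℝ) * (e * ∑ k ∈ Finset.Ioc 0 ⌊y / e⌋₊, (y / e - k)) := by
    have : ∀ k ∈ Finset.Ioc 0 ⌊y⌋₊, (if Nat.Coprime k u then (y - k) else 0) =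
        ∑ e ∈ u.divisors, (moebius e : ℝ) * (if e ∣ k then (y - k) else 0) := by
      intro k _
      have := coprime_ind u k hu0
      calc _ = (if Nat.Coprime k u then (1 : ℝ) else 0) * (y - k) := by split_ifs <;> simp
        _ = _ := by
          rw [this, Finset.sum_mul]
          apply Finset.sum_congr rfl
          intro e _
          split_ifs <;> simp
    rw [Finset.sum_congr rfl this, Finset.sum_comm]
    apply Finset.sum_congr rfl
    intro e he
    rw [← Finset.mul_sum, sum_mult y e (Nat.pos_of_mem_divisors he)]
  have h2 : 2 * ∑ k ∈ Finset.Ioc 0 ⌊y⌋₊, (if Nat.Coprime k u then (y - k) else 0)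
      - (u.totient : ℝ) / u * y ^ 2 = ∑ e ∈ u.divisors, (moebius e : ℝ) *
      (e * (2 * ∑ k ∈ Finset.Ioc 0 ⌊y / e⌋₊, (y / e - k) - ((y / e) ^ 2 - y / e))) := by
    have h3 := sum_moebius_divisors u hu0
    rw [if_neg (by omega)] at h3
    have h4 : ∑ e ∈ u.divisors, ((moebius e : ℝ) / e * y ^ 2 - moebius e * y) =
        (u.totient : ℝ) / u * y ^ 2 := by
      rw [Finset.sum_sub_distrib, ← Finset.sum_mul, ← Finset.sum_mul, h3, sum_moebius_div u hu0]
      ring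
    rw [h1, ← h4, Finset.mul_sum, ← Finset.sum_sub_distrib]
    apply Finset.sum_congr rfl
    intro e he
    have : (e : ℝ) ≠ 0 := by
      have := Nat.pos_of_mem_divisors he
      positivity
    field_simp
  rw [h2]
  refine (Finset.abs_sum_le_sum_abs _ _).trans ?_
  unfold sigmaFun
  push_cast
  rw [Finset.sum_div]
  apply Finset.sum_le_sum
  intro e _
  have hb := tri_bound (y / e) (by positivity)
  have hm : |(moebius e : ℝ)| ≤ 1 := by exact_mod_cast abs_moebius_le_one (n := e)
  rw [abs_mul, abs_mul, Nat.abs_cast]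
  set A := 2 * ∑ k ∈ Finset.Ioc 0 ⌊y / e⌋₊, (y / e - k) - ((y / e) ^ 2 - y / e) with hA
  have hA' : |A| ≤ 1 / 4 := by
    rw [abs_le] at hb ⊢
    constructor <;> linarith [hb.1, hb.2]
  calc |(moebius e : ℝ)| * (e * |A|) ≤ 1 * (e * (1 / 4)) := by gcongr
    _ = _ := by ring

/-- the coefficients `μ(d)/d²` restricted to `d` coprime to `u` -/
noncomputable def mobCoef (u d : ℕ) : ℝ :=
  if Nat.Coprime d u then (ArithmeticFunction.moebius d : ℝ) / (d : ℝ) ^ 2 else 0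

lemma mobCoef_abs (u d : ℕ) : |mobCoef u d| ≤ ((d : ℝ) ^ 2)⁻¹ := by
  unfold mobCoef
  have hm : |(ArithmeticFunction.moebius d : ℝ)| ≤ 1 := by
    exact_mod_cast ArithmeticFunction.abs_moebius_le_one (n := d)
  split_ifs
  · rw [abs_div, abs_of_nonneg (by positivity : (0 : ℝ) ≤ (d : ℝ) ^ 2), div_eq_mul_inv]
    exact mul_le_of_le_one_left (by positivity) hm
  · simp

lemma mobCoef_summable (u : ℕ) : Summable (mobCoef u) := by
  apply Summable.of_norm_bounded (g := fun d : ℕ => ((d : ℝ) ^ 2)⁻¹)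
  · exact Real.summable_nat_pow_inv.2 (by norm_num)
  · intro d
    exact mobCoef_abs u d

lemma mobCoef_tsum (u : ℕ) (hu : 0 < u) :
    (∏ p ∈ u.primeFactors, (1 - ((p : ℝ) ^ 2)⁻¹)) * (Real.pi ^ 2 / 6) * ∑' d, mobCoef u d = 1 := by
  have : NeZero u := ⟨hu.ne'⟩
  have h2 : 1 < (2 : ℂ).re := by norm_num
  have h := DirichletCharacter.LSeries.mul_mu_eq_one (1 : DirichletCharacter ℂ u) h2
  rw [← DirichletCharacter.LFunction_eq_LSeries _ h2] at h
  have h3 := DirichletCharacter.LFunctionTrivChar_eq_mul_riemannZeta (N := u) (s := 2) (by norm_num)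
  rw [DirichletCharacter.LFunctionTrivChar] at h3
  rw [h3, riemannZeta_two] at h
  have h4 : LSeries ((fun n : ℕ => (1 : DirichletCharacter ℂ u) n) *
      (fun n : ℕ => ((ArithmeticFunction.moebius n : ℤ) : ℂ))) 2 =
      ((∑' d, mobCoef u d : ℝ) : ℂ) := by
    rw [Complex.ofReal_tsum]
    unfold LSeries
    apply tsum_congr
    intro n
    rw [LSeries.term_def]
    unfold mobCoef
    split_ifs with h0 h1 h1
    · subst h0; simp
    · simp
    · have : IsUnit ((n : ℕ) : ZMod u) := (ZMod.isUnit_iff_coprime n u).2 h1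
      simp [MulChar.one_apply this]
    · have : ¬ IsUnit ((n : ℕ) : ZMod u) := fun h => h1 ((ZMod.isUnit_iff_coprime n u).1 h)
      simp [MulChar.map_nonunit _ this]
  have h5 : (∏ p ∈ u.primeFactors, (1 - (p : ℂ) ^ (-(2 : ℂ)))) =
      ((∏ p ∈ u.primeFactors, (1 - ((p : ℝ) ^ 2)⁻¹) : ℝ) : ℂ) := by
    push_cast
    apply Finset.prod_congr rfl
    intro p _
    rw [Complex.cpow_neg]
    norm_num
  rw [h5] at h
  have h6 := h4 ▸ h
  exact_mod_cast h6

lemma sigma_prod (u : ℕ) (hs : Squarefree u) :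
    (sigmaFun u : ℝ) = ∏ p ∈ u.primeFactors, (1 + (p : ℝ)) := by
  have := (ArithmeticFunction.isMultiplicative_id.natCast
    (R := ℝ)).prodPrimeFactors_one_add_of_squarefree hs
  simp only [ArithmeticFunction.natCoe_apply, ArithmeticFunction.id_apply] at this
  unfold sigmaFun
  push_cast
  rw [this]

lemma euler_id (u : ℕ) (hs : Squarefree u) :
    (u.totient : ℝ) / u * ∑' d, mobCoef u d = 6 / Real.pi ^ 2 * (u / sigmaFun u) := by
  have hu : 0 < u := Nat.pos_of_ne_zero hs.ne_zero
  have hu' : (u : ℝ) ≠ 0 := by positivity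
  have h := mobCoef_tsum u hu
  have h1 : (u.totient : ℝ) = u * ∏ p ∈ u.primeFactors, (1 - (p : ℝ)⁻¹) := by
    have h0 := congrArg (Rat.cast (K := ℝ)) (Nat.totient_eq_mul_prod_factors u)
    push_cast at h0
    exact h0
  have hsig := sigma_prod u hs
  have hprod : (u : ℝ) = ∏ p ∈ u.primeFactors, (p : ℝ) := by
    have h0 := congrArg (Nat.cast (R := ℝ)) (Nat.prod_primeFactors_of_squarefree hs).symm
    push_cast at h0
    exact h0
  have h2 : (sigmaFun u : ℝ) = u * ∏ p ∈ u.primeFactors, (1 + (p : ℝ)⁻¹) := by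
    rw [hsig, hprod]
    rw [← Finset.prod_mul_distrib]
    apply Finset.prod_congr rfl
    intro p hp
    have : (p : ℝ) ≠ 0 := by
      have := Nat.pos_of_mem_primeFactors hp
      positivity
    field_simp
    ring
  have h3 : (∏ p ∈ u.primeFactors, (1 - ((p : ℝ) ^ 2)⁻¹)) =
      (∏ p ∈ u.primeFactors, (1 - (p : ℝ)⁻¹)) * ∏ p ∈ u.primeFactors, (1 + (p : ℝ)⁻¹) := by
    rw [← Finset.prod_mul_distrib]
    apply Finset.prod_congr rfl
    intro p _
    rw [← inv_pow]
    ring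
  have h4 : 0 < ∏ p ∈ u.primeFactors, (1 + (p : ℝ)⁻¹) := Finset.prod_pos (fun p _ => by positivity)
  rw [h3] at h
  rw [h1, h2]
  set P := ∏ p ∈ u.primeFactors, (1 - (p : ℝ)⁻¹)
  set Q := ∏ p ∈ u.primeFactors, (1 + (p : ℝ)⁻¹)
  set S := ∑' d, mobCoef u d
  have hpi : Real.pi ≠ 0 := Real.pi_ne_zero
  have hQ := h4.ne'
  field_simp
  linarith

lemma mob_tail (u : ℕ) (Y : ℝ) (hY : 1 ≤ Y) :
    ∑' d, mobCoef u d ≤ ∑ d ∈ Finset.Ioc 0 ⌊Y⌋₊, mobCoef u d + (1 / Y + 1 / Y ^ 2) := by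
  set N := ⌊Y⌋₊ with hN
  have hlt : Y < (N + 1 : ℕ) := by exact_mod_cast Nat.lt_floor_add_one Y
  have ht := (mobCoef_summable u).hasSum.tendsto_sum_nat
  refine le_of_tendsto ht ?_
  filter_upwards [Filter.eventually_ge_atTop (N + 2)] with M hM
  obtain ⟨K, rfl⟩ : ∃ K, M = K + 1 := ⟨M - 1, by omega⟩
  have hz : mobCoef u 0 = 0 := by simp [mobCoef]
  have e1 : ∑ d ∈ Finset.range (K + 1), mobCoef u d = ∑ d ∈ Finset.Ioc 0 K, mobCoef u d := by
    symm
    apply Finset.sum_subset_zero_on_sdiff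
    · intro d; simp only [Finset.mem_Ioc, Finset.mem_range]; omega
    · intro d hd
      simp only [Finset.mem_Ioc, Finset.mem_range, Finset.mem_sdiff] at hd
      have : d = 0 := by omega
      rw [this, hz]
    · intros; rfl
  rw [e1, ← Finset.sum_Ioc_consecutive _ (Nat.zero_le N) (by omega : N ≤ K)]
  gcongr
  calc ∑ d ∈ Finset.Ioc N K, mobCoef u d ≤ ∑ d ∈ Finset.Ioc N K, ((d : ℝ) ^ 2)⁻¹ :=
        Finset.sum_le_sum fun d _ => (le_abs_self _).trans (mobCoef_abs u d)
    _ = (((N + 1 : ℕ) : ℝ) ^ 2)⁻¹ + ∑ d ∈ Finset.Ioc (N + 1) K, ((d : ℝ) ^ 2)⁻¹ := by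
        rw [← Finset.sum_Ioc_consecutive _ (Nat.le_succ N) (by omega : N + 1 ≤ K)]
        simp
    _ ≤ (((N + 1 : ℕ) : ℝ) ^ 2)⁻¹ + (((N + 1 : ℕ) : ℝ)⁻¹ - (K : ℝ)⁻¹) := by
        gcongr
        exact sum_Ioc_inv_sq_le_sub (by omega) (by omega)
    _ ≤ (Y ^ 2)⁻¹ + Y⁻¹ := by
        have : 0 ≤ (K : ℝ)⁻¹ := by positivity
        have h1 : (((N + 1 : ℕ) : ℝ) ^ 2)⁻¹ ≤ (Y ^ 2)⁻¹ := by gcongr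
        have h2 : ((N + 1 : ℕ) : ℝ)⁻¹ ≤ Y⁻¹ := by gcongr
        linarith
    _ = _ := by rw [one_div, one_div, add_comm]

lemma sum_swap (F : ℕ → ℕ → ℝ) (N : ℕ) :
    ∑ n ∈ Finset.Ioc 0 N, ∑ x ∈ n.divisorsAntidiagonal, F x.1 x.2 =
      ∑ d ∈ Finset.Ioc 0 N, ∑ k ∈ Finset.Ioc 0 (N / d), F d k := by
  rw [Finset.sum_sigma', Finset.sum_sigma']
  apply Finset.sum_bij' (fun x _ => (⟨x.2.1, x.2.2⟩ : (_ : ℕ) × ℕ))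
    (fun x _ => (⟨x.1 * x.2, (x.1, x.2)⟩ : (_ : ℕ) × (ℕ × ℕ)))
  · rintro ⟨n, a, b⟩ hx
    simp only [Finset.mem_sigma, Finset.mem_Ioc, Nat.mem_divisorsAntidiagonal] at hx ⊢
    obtain ⟨⟨h1, h2⟩, rfl, h3⟩ := hx
    have ha : 0 < a := Nat.pos_of_ne_zero fun h => by simp [h] at h1
    have hb : 0 < b := Nat.pos_of_ne_zero fun h => by simp [h] at h1
    refine ⟨⟨ha, ?_⟩, hb, ?_⟩
    · nlinarith
    · rw [Nat.le_div_iff_mul_le ha]; linarith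
  · rintro ⟨a, b⟩ hx
    simp only [Finset.mem_sigma, Finset.mem_Ioc, Nat.mem_divisorsAntidiagonal] at hx ⊢
    obtain ⟨⟨h1, h2⟩, h3, h4⟩ := hx
    rw [Nat.le_div_iff_mul_le h1] at h4
    have := Nat.mul_pos h1 h3
    exact ⟨⟨this, by linarith⟩, trivial, this.ne'⟩
  · rintro ⟨n, a, b⟩ hx
    simp only [Finset.mem_sigma, Finset.mem_Ioc, Nat.mem_divisorsAntidiagonal] at hx
    obtain ⟨⟨h1, h2⟩, rfl, h3⟩ := hx
    rfl
  · rintro ⟨a, b⟩ hx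
    rfl
  · rintro ⟨n, a, b⟩ hx
    rfl

open ArithmeticFunction in
lemma totient_sum_eq (u : ℕ) (Y : ℝ) :
    ∑ m ∈ Finset.Ioc 0 ⌊Y⌋₊, (if Nat.Coprime m u then (m.totient : ℝ) * (Y / m - 1) else 0) =
      ∑ d ∈ Finset.Ioc 0 ⌊Y⌋₊, (if Nat.Coprime d u then (moebius d : ℝ) else 0) *
        ∑ k ∈ Finset.Ioc 0 ⌊Y / d⌋₊, (if Nat.Coprime k u then (Y / d - k) else 0) := by
  have := sum_swap (fun d k => (if Nat.Coprime d u then (moebius d : ℝ) else 0) *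
    (if Nat.Coprime k u then (Y / d - k) else 0)) ⌊Y⌋₊
  simp only [← Finset.mul_sum] at this
  simp only [Nat.floor_div_natCast]
  rw [← this]
  apply Finset.sum_congr rfl
  intro m hm
  have hm0 : 0 < m := (Finset.mem_Ioc.1 hm).1
  have ht := (sum_eq_iff_sum_mul_moebius_eq (R := ℝ) (f := fun n => (n.totient : ℝ))
    (g := fun n => (n : ℝ))).1 (fun n _ => by exact_mod_cast Nat.sum_totient n) m hm0
  rw [← ht, Finset.sum_mul]
  split_ifs with hc
  · apply Finset.sum_congr rfl
    rintro ⟨a, b⟩ hx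
    rw [Nat.mem_divisorsAntidiagonal] at hx
    obtain ⟨rfl, h0⟩ := hx
    rw [Nat.coprime_mul_iff_left] at hc
    obtain ⟨hc1, hc2⟩ : a.Coprime u ∧ b.Coprime u := hc
    dsimp only
    rw [if_pos hc1, if_pos hc2]
    have ha : (a : ℝ) ≠ 0 := by
      intro h; simp at h; simp [h] at h0
    have hb : (b : ℝ) ≠ 0 := by
      intro h; simp at h; simp [h] at h0
    push_cast
    field_simp
  · symm
    apply Finset.sum_eq_zero
    rintro ⟨a, b⟩ hx
    rw [Nat.mem_divisorsAntidiagonal] at hx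
    obtain ⟨rfl, h0⟩ := hx
    rw [Nat.coprime_mul_iff_left] at hc
    simp only
    split_ifs with h1 h2
    · exact absurd ⟨h1, h2⟩ hc
    all_goals simp

open ArithmeticFunction in
lemma main_bound (u : ℕ) (hu : 1 < u) (hs : Squarefree u) (Y : ℝ) (hY : 1 ≤ Y) :
    6 / Real.pi ^ 2 * (u / sigmaFun u) * Y ^ 2
      - Y * ((sigmaFun u : ℝ) / 4 + (u.totient : ℝ) / u) - (u.totient : ℝ) / u ≤
    2 * ∑ m ∈ Finset.Ioc 0 ⌊Y⌋₊,
      (if Nat.Coprime m u then (m.totient : ℝ) * (Y / m - 1) else 0) := by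
  rw [totient_sum_eq, Finset.mul_sum]
  have hYpos : 0 < Y := by linarith
  have h1 : ∑ d ∈ Finset.Ioc 0 ⌊Y⌋₊, ((u.totient : ℝ) / u * Y ^ 2 * mobCoef u d
      - (sigmaFun u : ℝ) / 4) ≤ ∑ d ∈ Finset.Ioc 0 ⌊Y⌋₊,
      2 * ((if Nat.Coprime d u then (moebius d : ℝ) else 0) *
        ∑ k ∈ Finset.Ioc 0 ⌊Y / d⌋₊, (if Nat.Coprime k u then (Y / d - k) else 0)) := by
    apply Finset.sum_le_sum
    intro d hd
    have hd0 : 0 < d := (Finset.mem_Ioc.1 hd).1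
    have hd' : (d : ℝ) ≠ 0 := by positivity
    have hb := G_bound u hu (Y / d) (by positivity)
    set G := ∑ k ∈ Finset.Ioc 0 ⌊Y / d⌋₊, (if Nat.Coprime k u then (Y / d - k) else 0)
    unfold mobCoef
    split_ifs with hc
    · have hm : |(moebius d : ℝ)| ≤ 1 := by exact_mod_cast abs_moebius_le_one (n := d)
      have h3 : |(moebius d : ℝ) * (2 * G - (u.totient : ℝ) / u * (Y / d) ^ 2)|
          ≤ 1 * ((sigmaFun u : ℝ) / 4) := by
        rw [abs_mul]
        gcongr
      have h4 := (abs_le.1 h3).1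
      have h5 : (u.totient : ℝ) / u * Y ^ 2 * ((moebius d : ℝ) / (d : ℝ) ^ 2) =
          (moebius d : ℝ) * ((u.totient : ℝ) / u * (Y / d) ^ 2) := by
        field_simp
      rw [h5]
      linarith
    · have : (0 : ℝ) ≤ (sigmaFun u : ℝ) / 4 := by positivity
      linarith
  refine le_trans ?_ h1
  rw [Finset.sum_sub_distrib, ← Finset.mul_sum, ← euler_id u hs]
  simp only [Finset.sum_const, Nat.card_Ioc, nsmul_eq_mul, Nat.sub_zero]
  have h2 : (⌊Y⌋₊ : ℝ) * ((sigmaFun u : ℝ) / 4) ≤ Y * ((sigmaFun u : ℝ) / 4) := by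
    gcongr
    exact Nat.floor_le hYpos.le
  have h3 := mob_tail u Y hY
  have h4 : (u.totient : ℝ) / u * Y ^ 2 * ∑' d, mobCoef u d ≤ (u.totient : ℝ) / u * Y ^ 2 *
      (∑ d ∈ Finset.Ioc 0 ⌊Y⌋₊, mobCoef u d + (1 / Y + 1 / Y ^ 2)) := by gcongr
  have h5 : (u.totient : ℝ) / u * Y ^ 2 * (1 / Y + 1 / Y ^ 2) =
      (u.totient : ℝ) / u * Y + (u.totient : ℝ) / u := by
    have : (u : ℝ) ≠ 0 := by positivity
    field_simp
  rw [mul_add, h5] at h4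
  linarith

lemma reindex (u : ℕ) (hu : 0 < u) (X : ℝ) (F : ℕ → ℝ) :
    ∑ q ∈ (Finset.Icc 1 ⌊X⌋₊).filter (fun q => u ∣ q ∧ Nat.Coprime (q / u) u), F q =
      ∑ m ∈ Finset.Ioc 0 ⌊X / u⌋₊, (if Nat.Coprime m u then F (u * m) else 0) := by
  rw [← Finset.sum_filter]
  symm
  apply Finset.sum_bij (fun m _ => u * m)
  · intro m hm
    simp only [Finset.mem_filter, Finset.mem_Ioc, Finset.mem_Icc] at hm ⊢
    rw [Nat.floor_div_natCast, Nat.le_div_iff_mul_le hu] at hm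
    refine ⟨⟨Nat.mul_pos hu hm.1.1, by linarith [hm.1.2]⟩, dvd_mul_right _ _, ?_⟩
    rw [Nat.mul_div_cancel_left _ hu]
    exact hm.2
  · intro a _ b _ hab
    exact Nat.eq_of_mul_eq_mul_left hu hab
  · intro q hq
    simp only [Finset.mem_filter, Finset.mem_Icc] at hq
    obtain ⟨⟨h1, h2⟩, ⟨c, rfl⟩, h3⟩ := hq
    rw [Nat.mul_div_cancel_left _ hu] at h3
    refine ⟨c, ?_, rfl⟩
    rw [Finset.mem_filter, Finset.mem_Ioc, Nat.floor_div_natCast, Nat.le_div_iff_mul_le hu]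
    exact ⟨⟨Nat.pos_of_mul_pos_left h1, by linarith⟩, h3⟩
  · intro m _
    rfl

lemma sigmaFun_pos (u : ℕ) (hu : 0 < u) : 0 < sigmaFun u := by
  unfold sigmaFun
  exact Finset.sum_pos (fun d hd => Nat.pos_of_mem_divisors hd) ⟨1, by simp [hu.ne']⟩

/-- Lower bound for `N_u(X)`, the number of integer points in the union of the intervals
`I(q,t) = (tf/q, (tf+H)/q - h + 1]` and `J(q,t) = [(tf-H)/q, tf/q - h + 1)`, summed over
`0 ≤ t < q ≤ X` with `gcd(t,q) = 1` and `u‖q`: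
`N_u(X) ≥ E_u(X)·(6/π²)·(1/u)·(φ(u)/σ(u))·X²·h`. -/
theorem N_u_lower_bound (f : ℕ) (hf : f.Prime) (h : ℕ) (hh : 0 < h)
    (u : ℕ) (hu : 1 < u) (huSq : Squarefree u)
    (H : ℝ) (hH0 : 0 < H) (hHf : H < f)
    (X : ℝ) (hX : X = H / h) (hXu : X / u ≥ 1) :
    EFun u X * (6 / Real.pi ^ 2) * (1 / u) * ((Nat.totient u : ℝ) / (sigmaFun u : ℝ)) *
        X ^ 2 * h ≤
      ∑ q ∈ (Finset.Icc 1 ⌊X⌋₊).filter (fun q => u ∣ q ∧ Nat.Coprime (q / u) u),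
        ∑ t ∈ (Finset.range q).filter (fun t => Nat.Coprime t q),
          ((countIoc ((t * f : ℝ) / q) (((t * f : ℝ) + H) / q - h + 1) : ℝ) +
            (countIco (((t * f : ℝ) - H) / q) ((t * f : ℝ) / q - h + 1) : ℝ)) := by

  have hu0 : 0 < u := by omega
  have huR : (0 : ℝ) < u := by positivity
  have hhR : (0 : ℝ) < h := by positivity
  have hXpos : 0 < X := by rw [hX]; positivity
  have hHX : H = X * h := by rw [hX]; field_simp
  have step1 : ∑ q ∈ (Finset.Icc 1 ⌊X⌋₊).filter (fun q => u ∣ q ∧ Nat.Coprime (q / u) u),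
      (q.totient : ℝ) * (2 * (h * (X / q - 1))) ≤
      ∑ q ∈ (Finset.Icc 1 ⌊X⌋₊).filter (fun q => u ∣ q ∧ Nat.Coprime (q / u) u),
        ∑ t ∈ (Finset.range q).filter (fun t => Nat.Coprime t q),
          ((countIoc ((t * f : ℝ) / q) (((t * f : ℝ) + H) / q - h + 1) : ℝ) +
            (countIco (((t * f : ℝ) - H) / q) ((t * f : ℝ) / q - h + 1) : ℝ)) := by
    apply Finset.sum_le_sum
    intro q hq
    have hq1 : 1 ≤ q := (Finset.mem_Icc.1 (Finset.mem_filter.1 hq).1).1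
    have hqR : (0 : ℝ) < q := by exact_mod_cast hq1
    have hcard : q.totient = ((Finset.range q).filter (fun t => Nat.Coprime t q)).card := by
      rw [Nat.totient_eq_card_coprime]
      congr 1
      apply Finset.filter_congr
      intro t _
      exact Nat.coprime_comm
    rw [hcard, ← nsmul_eq_mul]
    apply Finset.card_nsmul_le_sum
    intro t _
    have a1 := countIoc_ge ((t * f : ℝ) / q) (((t * f : ℝ) + H) / q - h + 1)
    have a2 := countIco_ge (((t * f : ℝ) - H) / q) ((t * f : ℝ) / q - h + 1)
    rw [add_div] at a1
    rw [sub_div] at a2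
    have a3 : h * (X / q - 1) = H / q - h := by
      rw [hHX]; field_simp
    rw [a3]
    rw [add_div, sub_div]
    linarith
  refine le_trans ?_ step1
  rw [reindex u hu0 X]
  have hmb := main_bound u hu huSq (X / u) hXu
  have e1 : ∑ m ∈ Finset.Ioc 0 ⌊X / u⌋₊, (if Nat.Coprime m u then
      ((u * m).totient : ℝ) * (2 * (h * (X / ((u * m : ℕ) : ℝ) - 1))) else 0) =
      h * u.totient * (2 * ∑ m ∈ Finset.Ioc 0 ⌊X / u⌋₊,
      (if Nat.Coprime m u then (m.totient : ℝ) * (X / u / m - 1) else 0)) := by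
    rw [Finset.mul_sum, Finset.mul_sum]
    apply Finset.sum_congr rfl
    intro m _
    split_ifs with hc
    · rw [Nat.totient_mul hc.symm]
      push_cast
      rw [div_div]
      ring
    · simp
  rw [e1]
  refine le_trans (le_of_eq ?_) (mul_le_mul_of_nonneg_left hmb (by positivity))
  have hσ : (0 : ℝ) < sigmaFun u := by exact_mod_cast sigmaFun_pos u hu0
  unfold EFun
  have hpi := Real.pi_ne_zero
  field_simp
  ring
end

section
/- Let f ≥ 10^14 be a prime and let χ be a Dirichlet character modulo f of order 3 with χ(2) ∉ {0,1} (so that q₁ = 2 is the smallest prime cubic non-residue modulo f), and let q₂ be the smallest prime greater than 2 with χ(q₂) ∉ {0,1} (assumed to exist). Then for every complex cube root of unity ω with ω ≠ 1 there exists a positive integer m with gcd(m, 2q₂) = 1, χ(m) = ω, and 3·q₂·m ≤ f. -/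
/-- Counting differences of odd numbers by parity. -/
theorem comb_id {f : ℕ} (φ : ZMod f → ℂ) (hφ : ∀ x, φ (-x) = φ x) (H : ℕ) :
    ∑ a ∈ Finset.range H, ∑ b ∈ Finset.range H, φ (2 * a + 1 - 2 * b) =
      ∑ i ∈ Finset.range H, ((2 * H - (2 * i + 1) : ℝ) : ℂ) * φ (2 * i + 1) := by
  induction H with
  | zero => simp
  | succ H ih =>
    have e1 : ∑ a ∈ Finset.range H, φ (2 * a + 1 - 2 * (H : ZMod f)) =
        ∑ i ∈ Finset.range H, φ (2 * i + 1) := by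
      rw [← Finset.sum_range_reflect]
      refine Finset.sum_congr rfl fun i hi => ?_
      rw [← hφ]
      congr 1
      have : i < H := Finset.mem_range.1 hi
      have h2 : ((H - 1 - i : ℕ) : ZMod f) = H - 1 - i := by
        rw [Nat.cast_sub (by omega), Nat.cast_sub (by omega)]; simp
      rw [h2]; ring
    have e2 : ∑ b ∈ Finset.range (H + 1), φ (2 * (H : ZMod f) + 1 - 2 * b) =
        ∑ i ∈ Finset.range (H + 1), φ (2 * i + 1) := by
      rw [← Finset.sum_range_reflect]
      refine Finset.sum_congr rfl fun i hi => ?_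
      congr 1
      have : i < H + 1 := Finset.mem_range.1 hi
      have h2 : ((H + 1 - 1 - i : ℕ) : ZMod f) = H - i := by
        rw [Nat.cast_sub (by omega)]; simp
      rw [h2]; ring
    rw [Finset.sum_range_succ, e2]
    simp_rw [Finset.sum_range_succ _ H]
    rw [Finset.sum_add_distrib, ih, e1]
    have e3 : ∑ i ∈ Finset.range H, ((2 * (H + 1 : ℕ) - (2 * i + 1) : ℝ) : ℂ) * φ (2 * i + 1) =
      ∑ i ∈ Finset.range H, ((2 * H - (2 * i + 1) : ℝ) : ℂ) * φ (2 * i + 1)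
       + 2 * ∑ i ∈ Finset.range H, φ (2 * i + 1) := by
      rw [Finset.mul_sum, ← Finset.sum_add_distrib]
      refine Finset.sum_congr rfl fun i hi => ?_
      push_cast; ring
    rw [e3]
    push_cast; ring

theorem corr {f : ℕ} [Fact f.Prime] (χ : DirichletCharacter ℂ f) (hχ : χ ≠ 1) (u v : ZMod f)
    (huv : u ≠ v) : ∑ x : ZMod f, χ (x - u) * χ⁻¹ (x - v) = -1 := by
  have hc : v - u ≠ 0 := sub_ne_zero.2 huv.symm
  have h1 := jacobiSum_nontrivial_inv (χ := χ) hχ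
  rw [jacobiSum] at h1
  have e : ∑ x : ZMod f, χ (x - u) * χ⁻¹ (x - v) =
      ∑ z : ZMod f, χ (-1) * (χ z * χ⁻¹ (1 - z)) := by
    refine (Fintype.sum_equiv ((Equiv.mulLeft₀ (v - u) hc).trans (Equiv.addRight u)) _ _ ?_).symm
    intro z
    change _ = χ ((v - u) * z + u - u) * χ⁻¹ ((v - u) * z + u - v)
    have a1 : (v - u) * z + u - u = (v - u) * z := by ring
    have a2 : (v - u) * z + u - v = (v - u) * (-1 * (1 - z)) := by ring
    rw [a1, a2, map_mul, map_mul, map_mul]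
    have a3 : χ (v - u) * χ⁻¹ (v - u) = 1 := by
      rw [← MulChar.mul_apply, mul_inv_cancel, MulChar.one_apply (isUnit_iff_ne_zero.2 hc)]
    have a4 : χ⁻¹ (-1) = χ (-1) := by
      rw [MulChar.inv_apply']; simp [inv_neg]
    rw [a4]
    linear_combination (- χ z * χ (-1) * χ⁻¹ (1 - z)) * a3
  rw [e, ← Finset.mul_sum, h1, mul_neg, ← map_mul]; simp

theorem second_moment {f : ℕ} [Fact f.Prime] (χ : DirichletCharacter ℂ f) (hχ : χ ≠ 1) (H : ℕ)
    (g : ℕ → ZMod f) (hg : Set.InjOn g (Finset.range H)) :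
    ∑ x : ZMod f, ‖∑ b ∈ Finset.range H, χ (x - g b)‖ ^ 2 ≤ f * H := by
  have key : ((∑ x : ZMod f, ‖∑ b ∈ Finset.range H, χ (x - g b)‖ ^ 2 : ℝ) : ℂ) =
      ∑ b ∈ Finset.range H, ∑ c ∈ Finset.range H, ∑ x : ZMod f, χ (x - g b) * χ⁻¹ (x - g c) := by
    push_cast
    have : ∀ x : ZMod f, ((‖∑ b ∈ Finset.range H, χ (x - g b)‖ : ℂ)) ^ 2 =
        ∑ b ∈ Finset.range H, ∑ c ∈ Finset.range H, χ (x - g b) * χ⁻¹ (x - g c) := by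
      intro x
      rw [← Complex.mul_conj', map_sum, Finset.sum_mul_sum]
      refine Finset.sum_congr rfl fun b _ => Finset.sum_congr rfl fun c _ => ?_
      rw [← MulChar.star_apply']; rfl
    simp_rw [this]
    rw [Finset.sum_comm]
    refine Finset.sum_congr rfl fun b _ => ?_
    rw [Finset.sum_comm]
  have h2 : ∑ x : ZMod f, ‖∑ b ∈ Finset.range H, χ (x - g b)‖ ^ 2 =
     ∑ b ∈ Finset.range H, ∑ c ∈ Finset.range H,
      (∑ x : ZMod f, χ (x - g b) * χ⁻¹ (x - g c)).re := by
    rw [← Complex.ofReal_re (∑ x : ZMod f, ‖∑ b ∈ Finset.range H, χ (x - g b)‖ ^ 2), key]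
    simp only [Complex.re_sum]
  rw [h2]
  calc _ ≤ ∑ b ∈ Finset.range H, ∑ c ∈ Finset.range H, (if b = c then (f : ℝ) else 0) := by
        refine Finset.sum_le_sum fun b hb => Finset.sum_le_sum fun c hc => ?_
        split_ifs with hbc
        · refine (Complex.re_le_norm _).trans ((norm_sum_le _ _).trans ?_)
          calc _ ≤ ∑ x : ZMod f, (1 : ℝ) := by
                refine Finset.sum_le_sum fun x _ => ?_
                rw [norm_mul]
                exact mul_le_one₀ (DirichletCharacter.norm_le_one _ _) (norm_nonneg _)
                  (DirichletCharacter.norm_le_one _ _)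
            _ = f := by simp [ZMod.card]
        · rw [corr χ hχ _ _ (fun h => hbc (hg (by simpa using hb) (by simpa using hc) h))]
          simp
    _ = f * H := by
        have : ∀ b ∈ Finset.range H,
            ∑ c ∈ Finset.range H, (if b = c then (f : ℝ) else 0) = f := by
          intro b hb
          rw [Finset.sum_ite_eq, if_pos hb]
        rw [Finset.sum_congr rfl this]
        simp [mul_comm]

theorem odd_pv {f : ℕ} [Fact f.Prime] (χ : DirichletCharacter ℂ f) (hχ : χ ≠ 1)
    (hev : χ (-1) = 1) (H : ℕ) (hH : 2 * H < f) :
    ‖∑ i ∈ Finset.range H, ((2 * H - (2 * i + 1) : ℝ) : ℂ) * χ ((2 * i + 1 : ℕ) : ZMod f)‖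
      ≤ H * √f := by
  have h1 := comb_id (fun x => χ x) (fun x => by
    rw [neg_eq_neg_one_mul, map_mul, hev, one_mul]) H
  push_cast at h1 ⊢
  rw [← h1]
  have inj : ∀ k : ℕ, k ≤ 1 →
      Set.InjOn (fun b : ℕ => ((2 * b + k : ℕ) : ZMod f)) (Finset.range H) := by
    intro k hk a ha b hb hab
    simp only [Finset.coe_range, Set.mem_Iio] at ha hb
    have := (ZMod.natCast_eq_natCast_iff' _ _ _).1 hab
    rw [Nat.mod_eq_of_lt (by omega), Nat.mod_eq_of_lt (by omega)] at this
    omega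
  have h2 := second_moment χ hχ H (fun b : ℕ => ((2 * b + 0 : ℕ) : ZMod f)) (inj 0 (by norm_num))
  push_cast at h2
  simp only [add_zero] at h2
  set G : ZMod f → ℝ := fun x => ‖∑ b ∈ Finset.range H, χ (x - 2 * (b : ZMod f))‖ with hG
  have h3 : ‖∑ a ∈ Finset.range H, ∑ b ∈ Finset.range H, χ (2 * (a : ZMod f) + 1 - 2 * b)‖
      ≤ ∑ a ∈ Finset.range H, G ((2 * a + 1 : ℕ) : ZMod f) := by
    refine (norm_sum_le _ _).trans (le_of_eq ?_)
    simp [hG]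
  have h4 : ∑ a ∈ Finset.range H, G ((2 * a + 1 : ℕ) : ZMod f) ^ 2 ≤ f * H := by
    refine le_trans ?_ h2
    rw [← Finset.sum_image (f := fun x => G x ^ 2) (inj 1 le_rfl)]
    exact Finset.sum_le_sum_of_subset_of_nonneg (Finset.subset_univ _)
      (fun _ _ _ => sq_nonneg _)
  have h5 := sq_sum_le_card_mul_sum_sq (s := Finset.range H)
    (f := fun a : ℕ => G ((2 * a + 1 : ℕ) : ZMod f))
  rw [Finset.card_range] at h5
  refine h3.trans (abs_le_of_sq_le_sq' ?_ (by positivity)).2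
  rw [mul_pow, Real.sq_sqrt (by positivity)]
  calc _ ≤ _ := h5
    _ ≤ H * (f * H) := by gcongr
    _ = _ := by ring

theorem conc_pair (M c h : ℝ) (hh : |h| < c) :
    (M - (c + h)) * Real.log (c + h) + (M - (c - h)) * Real.log (c - h) ≤
      2 * ((M - c) * Real.log c) ∨ M < c := by
  by_cases hM : M < c
  · exact Or.inr hM
  left
  push Not at hM
  have hc : 0 < c := lt_of_le_of_lt (abs_nonneg h) hh
  have ⟨h1, h2⟩ := abs_lt.1 hh
  have p1 : 0 < c + h := by linarith
  have p2 : 0 < c - h := by linarith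
  have e1 : Real.log (c + h) + Real.log (c - h) ≤ 2 * Real.log c := by
    rw [← Real.log_mul p1.ne' p2.ne', two_mul, ← Real.log_mul hc.ne' hc.ne']
    apply Real.log_le_log (by positivity)
    nlinarith [sq_nonneg h]
  have e2 : 0 ≤ h * (Real.log (c + h) - Real.log (c - h)) := by
    rcases le_total 0 h with h0 | h0
    · apply mul_nonneg h0
      have := Real.log_le_log p2 (by linarith : c - h ≤ c + h)
      linarith
    · apply mul_nonneg_of_nonpos_of_nonpos h0
      have := Real.log_le_log p1 (by linarith : c + h ≤ c - h)
      linarith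
  nlinarith [mul_le_mul_of_nonneg_left e1 (sub_nonneg.2 hM)]

theorem conc_block (M : ℝ) (u j : ℕ) (hM : ((2 * u + 1) * (2 * j + 1) : ℝ) ≤ M) :
    ∑ r ∈ Finset.range (2 * u + 1),
      (M - (2 * ((2 * u + 1) * j + r : ℕ) + 1)) * Real.log (2 * ((2 * u + 1) * j + r : ℕ) + 1) ≤
    (2 * u + 1) * ((M - (2 * u + 1) * (2 * j + 1)) * Real.log ((2 * u + 1) * (2 * j + 1))) := by
  set c : ℝ := (2 * u + 1) * (2 * j + 1) with hc
  set g : ℝ → ℝ := fun x => (M - x) * Real.log x with hg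
  have e1 : ∑ r ∈ Finset.range (2 * u + 1),
      (M - (2 * ((2 * u + 1) * j + r : ℕ) + 1)) * Real.log (2 * ((2 * u + 1) * j + r : ℕ) + 1) =
      ∑ r ∈ Finset.range (2 * u + 1), g (c + 2 * ((r : ℝ) - u)) := by
    refine Finset.sum_congr rfl fun r _ => ?_
    have : (2 * ((2 * u + 1) * j + r : ℕ) + 1 : ℝ) = c + 2 * ((r : ℝ) - u) := by
      rw [hc]; push_cast; ring
    rw [this]
  have e2 : ∑ r ∈ Finset.range (2 * u + 1), g (c + 2 * ((r : ℝ) - u)) =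
      ∑ r ∈ Finset.range (2 * u + 1), g (c - 2 * ((r : ℝ) - u)) := by
    rw [← Finset.sum_range_reflect]
    refine Finset.sum_congr rfl fun r hr => ?_
    have : r < 2 * u + 1 := Finset.mem_range.1 hr
    rw [Nat.cast_sub (by omega)]
    congr 1; push_cast; ring
  have e3 : ∑ r ∈ Finset.range (2 * u + 1), (g (c + 2 * ((r : ℝ) - u)) + g (c - 2 * ((r : ℝ) - u)))
      ≤ ∑ r ∈ Finset.range (2 * u + 1), 2 * g c := by
    refine Finset.sum_le_sum fun r hr => ?_
    have hr' : (r : ℝ) ≤ 2 * u := by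
      have : r < 2 * u + 1 := Finset.mem_range.1 hr
      exact_mod_cast (by omega : r ≤ 2 * u)
    have hr0 : (0 : ℝ) ≤ r := by positivity
    rcases conc_pair M c (2 * ((r : ℝ) - u)) (by
      rw [abs_lt, hc]
      have : (0 : ℝ) ≤ (2 * u + 1) * (2 * j) := by positivity
      constructor <;> nlinarith) with h | h
    · exact h
    · linarith
  rw [Finset.sum_add_distrib, ← e2, Finset.sum_const, Finset.card_range] at e3
  rw [e1]
  simp only [nsmul_eq_mul, hg] at e3 ⊢
  push_cast at e3
  linarith

/-- The weighted sum of `log n` over odd `n < 2H`. -/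
noncomputable def oddLog (H : ℕ) : ℝ :=
  ∑ i ∈ Finset.range H, (2 * H - (2 * i + 1) : ℝ) * Real.log (2 * i + 1)

theorem sum_w (H : ℕ) : ∑ i ∈ Finset.range H, (2 * H - (2 * i + 1) : ℝ) = H ^ 2 := by
  have : ∀ J : ℕ, ∑ i ∈ Finset.range J, (2 * H - (2 * i + 1) : ℝ) = 2 * H * J - J ^ 2 := by
    intro J
    induction J with
    | zero => simp
    | succ J ih => rw [Finset.sum_range_succ, ih]; push_cast; ring
  rw [this]; ring

theorem oddLog_scale (u R : ℕ) :
    oddLog ((2 * u + 1) * R) ≤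
      (2 * u + 1) ^ 2 * (oddLog R + R ^ 2 * Real.log (2 * u + 1)) := by
  have reg : ∀ (h : ℕ → ℝ) (t J : ℕ), ∑ i ∈ Finset.range (t * J), h i =
      ∑ j ∈ Finset.range J, ∑ r ∈ Finset.range t, h (t * j + r) := by
    intro h t J
    induction J with
    | zero => simp
    | succ J ih => rw [Nat.mul_succ, Finset.sum_range_add, ih, Finset.sum_range_succ]
  unfold oddLog
  rw [reg]
  have : ∀ j ∈ Finset.range R, ∑ r ∈ Finset.range (2 * u + 1),
      (2 * ((2 * u + 1) * R : ℕ) - (2 * ((2 * u + 1) * j + r : ℕ) + 1) : ℝ) *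
        Real.log (2 * ((2 * u + 1) * j + r : ℕ) + 1) ≤
      (2 * u + 1) ^ 2 * ((2 * R - (2 * j + 1)) * Real.log (2 * j + 1) +
        (2 * R - (2 * j + 1)) * Real.log (2 * u + 1)) := by
    intro j hj
    have hj' : ((2 * j + 1 : ℕ) : ℝ) ≤ (2 * R : ℕ) := by
      have := Finset.mem_range.1 hj
      exact_mod_cast (by omega)
    push_cast at hj'
    refine (conc_block _ u j ?_).trans (le_of_eq ?_)
    · push_cast
      nlinarith
    · rw [Real.log_mul (by positivity) (by positivity)]
      push_cast; ring
  refine (Finset.sum_le_sum this).trans (le_of_eq ?_)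
  rw [← Finset.mul_sum, Finset.sum_add_distrib, ← Finset.sum_mul, sum_w]

/-- Weighted count of odd multiples of `d` below `2H`. -/
noncomputable def mulW (H d : ℕ) : ℝ :=
  ∑ i ∈ Finset.range H, if d ∣ 2 * i + 1 then (2 * H - (2 * i + 1) : ℝ) else 0

theorem mulW_even (H d : ℕ) (hd : ¬ Odd d) : mulW H d = 0 := by
  unfold mulW
  refine Finset.sum_eq_zero fun i _ => ?_
  rw [if_neg]
  intro h
  exact hd (Odd.of_dvd_nat ⟨i, rfl⟩ h)

theorem mulW_odd (H d : ℕ) (hd : Odd d) : ∃ J : ℕ, mulW H d = 2 * H * J - d * J ^ 2 ∧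
    |(2 * H - 2 * d * J : ℝ)| ≤ d := by
  obtain ⟨e, he⟩ := hd
  set J := (2 * H / d + 1) / 2 with hJ
  have hd0 : 0 < d := by omega
  have hJk : ∀ k, k < J ↔ d * (2 * k + 1) ≤ 2 * H := by
    intro k
    have : k < J ↔ 2 * k + 1 ≤ 2 * H / d := by omega
    rw [this, Nat.le_div_iff_mul_le hd0, mul_comm]
  have hodd : ∀ k, d * (2 * k + 1) = 2 * (d * k + e) + 1 := by intro k; rw [he]; ring
  refine ⟨J, ?_, ?_⟩
  · have img : (Finset.range H).filter (fun i => d ∣ 2 * i + 1) =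
        (Finset.range J).image (fun k => d * k + e) := by
      ext i
      simp only [Finset.mem_filter, Finset.mem_range, Finset.mem_image]
      constructor
      · rintro ⟨hi, m, hm⟩
        have hmo : Odd m := Odd.of_dvd_nat (⟨i, rfl⟩ : Odd (2 * i + 1)) ⟨d, by rw [hm, mul_comm]⟩
        obtain ⟨k, hk⟩ := hmo
        have := hodd k
        rw [← hk, ← hm] at this
        refine ⟨k, (hJk k).2 ?_, by omega⟩
        rw [← hk, ← hm]; omega
      · rintro ⟨k, hk, rfl⟩
        have h1 := (hJk k).1 hk
        have h2 := hodd k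
        exact ⟨by omega, ⟨2 * k + 1, h2.symm⟩⟩
    unfold mulW
    rw [← Finset.sum_filter, img, Finset.sum_image]
    · have : ∀ L : ℕ, ∑ k ∈ Finset.range L, (2 * H - (2 * (d * k + e : ℕ) + 1) : ℝ) =
          2 * H * L - d * L ^ 2 := by
        intro L
        induction L with
        | zero => simp
        | succ L ih => rw [Finset.sum_range_succ, ih, he]; push_cast; ring
      exact this J
    · intro a _ b _ hab
      simp only at hab
      have : d * a = d * b := by omega
      exact Nat.eq_of_mul_eq_mul_left hd0 this
  · have h1 := (hJk J).not.1 (lt_irrefl _)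
    have h1' : (2 * H : ℝ) ≤ d * (2 * J + 1) := by exact_mod_cast (by omega : 2 * H ≤ d * (2 * J + 1))
    rw [abs_le]
    refine ⟨?_, by linarith⟩
    rcases Nat.eq_zero_or_pos J with h0 | h0
    · rw [h0]; push_cast
      have : (0 : ℝ) ≤ H := by positivity
      have : (0 : ℝ) ≤ d := by positivity
      linarith
    · have h2 := (hJk (J - 1)).1 (by omega)
      have h3 : d * (2 * J) ≤ 2 * H + d := by
        have : d * (2 * (J - 1) + 1) + d = d * (2 * J) := by
          obtain ⟨l, hl⟩ : ∃ l, J = l + 1 := ⟨J - 1, by omega⟩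
          rw [hl]; simp; ring
        omega
      have h3' : (d * (2 * J) : ℝ) ≤ 2 * H + d := by exact_mod_cast h3
      linarith

theorem mulW_bounds (H d : ℕ) (hd : Odd d) :
    (H : ℝ) ^ 2 / d - d / 4 ≤ mulW H d ∧ mulW H d ≤ (H : ℝ) ^ 2 / d := by
  obtain ⟨J, h1, h2⟩ := mulW_odd H d hd
  have hd0 : (0 : ℝ) < d := by exact_mod_cast hd.pos
  have e : mulW H d = (H : ℝ) ^ 2 / d - (2 * H - 2 * d * J) ^ 2 / (4 * d) := by
    rw [h1]; field_simp; ring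
  have h3 : (2 * H - 2 * d * J : ℝ) ^ 2 ≤ d ^ 2 := sq_le_sq' (abs_le.1 h2).1 (abs_le.1 h2).2
  rw [e]
  constructor
  · have : (2 * H - 2 * d * J : ℝ) ^ 2 / (4 * d) ≤ d / 4 := by
      rw [div_le_div_iff₀ (by positivity) (by positivity)]
      nlinarith
    linarith
  · have : 0 ≤ (2 * H - 2 * d * J : ℝ) ^ 2 / (4 * d) := by positivity
    linarith

open ArithmeticFunction in
theorem sum_log_swap (H D : ℕ) :
    ∑ i ∈ Finset.range H, (2 * H - (2 * i + 1) : ℝ) *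
      (∑ d ∈ Finset.range D, if d ∣ 2 * i + 1 then vonMangoldt d else 0) =
    ∑ d ∈ Finset.range D, vonMangoldt d * mulW H d := by
  simp_rw [Finset.mul_sum]
  rw [Finset.sum_comm]
  refine Finset.sum_congr rfl fun d _ => ?_
  unfold mulW
  rw [Finset.mul_sum]
  refine Finset.sum_congr rfl fun i _ => ?_
  split_ifs <;> ring

open ArithmeticFunction in
theorem oddLog_le (R : ℕ) : oddLog R ≤
    R ^ 2 * ∑ d ∈ (Finset.range (2 * R)).filter Odd, vonMangoldt d / d := by
  have e : oddLog R = ∑ d ∈ Finset.range (2 * R), vonMangoldt d * mulW R d := by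
    rw [← sum_log_swap]
    unfold oddLog
    refine Finset.sum_congr rfl fun i hi => ?_
    have hi' := Finset.mem_range.1 hi
    congr 1
    have := vonMangoldt_sum (n := 2 * i + 1)
    push_cast at this
    rw [← this, ← Finset.sum_filter]
    refine Finset.sum_congr ?_ fun _ _ => rfl
    ext d
    simp only [Nat.mem_divisors, Finset.mem_filter, Finset.mem_range]
    constructor
    · rintro ⟨h, _⟩
      exact ⟨by have := Nat.le_of_dvd (by omega) h; omega, h⟩
    · rintro ⟨_, h⟩
      exact ⟨h, by omega⟩
  rw [e, Finset.mul_sum, Finset.sum_filter]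
  refine Finset.sum_le_sum fun d _ => ?_
  split_ifs with hd
  · calc _ ≤ vonMangoldt d * ((R : ℝ) ^ 2 / d) :=
          mul_le_mul_of_nonneg_left (mulW_bounds R d hd).2 vonMangoldt_nonneg
      _ = _ := by ring
  · rw [mulW_even _ _ hd]; simp

open ArithmeticFunction Classical in
theorem rough_bound (u R : ℕ) (hR : 0 < R) :
    Real.log (2 * R) * (∑ i ∈ Finset.range ((2 * u + 1) * R),
      if (∃ p : ℕ, p.Prime ∧ p ∣ 2 * i + 1 ∧ 2 * R ≤ p) then
        (2 * ((2 * u + 1) * R : ℕ) - (2 * i + 1) : ℝ) else 0) ≤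
    ((2 * u + 1) * R) ^ 2 * Real.log (2 * u + 1) + R ^ 2 * Real.log (2 * R) := by
  set H := (2 * u + 1) * R with hH
  set L := ∑ d ∈ (Finset.range (2 * R)).filter Odd, vonMangoldt d / d with hL
  have hHr : (H : ℝ) = (2 * u + 1) * R := by rw [hH]; push_cast; ring
  have s1 : Real.log (2 * R) * (∑ i ∈ Finset.range H,
      if (∃ p : ℕ, p.Prime ∧ p ∣ 2 * i + 1 ∧ 2 * R ≤ p) then
        (2 * H - (2 * i + 1) : ℝ) else 0) ≤ ∑ i ∈ Finset.range H, (2 * H - (2 * i + 1) : ℝ) *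
      (Real.log (2 * i + 1) -
        ∑ d ∈ Finset.range (2 * R), if d ∣ 2 * i + 1 then vonMangoldt d else 0) := by
    rw [Finset.mul_sum]
    refine Finset.sum_le_sum fun i hi => ?_
    have hw : (0 : ℝ) ≤ 2 * H - (2 * i + 1) := by
      have := Finset.mem_range.1 hi
      have : ((2 * i + 1 : ℕ) : ℝ) ≤ (2 * H : ℕ) := by exact_mod_cast (by omega)
      push_cast at this; linarith
    have hs := vonMangoldt_sum (n := 2 * i + 1)
    push_cast at hs
    rw [← Finset.sum_filter]
    split_ifs with h
    · obtain ⟨p, hp, hpd, hpR⟩ := h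
      rw [mul_comm]
      refine mul_le_mul_of_nonneg_left ?_ hw
      have hnot : p ∉ (Finset.range (2 * R)).filter (fun d => d ∣ 2 * i + 1) := by
        simp; omega
      have sub : insert p ((Finset.range (2 * R)).filter (fun d => d ∣ 2 * i + 1)) ⊆
          (2 * i + 1).divisors := by
        intro d hd
        rw [Finset.mem_insert, Finset.mem_filter] at hd
        rw [Nat.mem_divisors]
        rcases hd with rfl | hd
        · exact ⟨hpd, by omega⟩
        · exact ⟨hd.2, by omega⟩
      have := Finset.sum_le_sum_of_subset_of_nonneg (f := fun d => vonMangoldt d) sub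
        (fun _ _ _ => vonMangoldt_nonneg)
      rw [Finset.sum_insert hnot, hs, vonMangoldt_apply_prime hp] at this
      have h2 : Real.log (2 * R) ≤ Real.log p :=
        Real.log_le_log (by positivity) (by exact_mod_cast hpR)
      linarith
    · rw [mul_zero]
      refine mul_nonneg hw ?_
      have sub : ((Finset.range (2 * R)).filter (fun d => d ∣ 2 * i + 1)) ⊆
          (2 * i + 1).divisors := by
        intro d hd
        rw [Finset.mem_filter] at hd
        rw [Nat.mem_divisors]
        exact ⟨hd.2, by omega⟩
      have := Finset.sum_le_sum_of_subset_of_nonneg (f := fun d => vonMangoldt d) sub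
        (fun _ _ _ => vonMangoldt_nonneg)
      rw [hs] at this
      linarith
  refine s1.trans ?_
  simp_rw [mul_sub (_ : ℝ) (Real.log _)]
  rw [Finset.sum_sub_distrib, sum_log_swap]
  have s2 := oddLog_scale u R
  have s3 := oddLog_le R
  rw [← hL] at s3
  have s4 : (H : ℝ) ^ 2 * L - R ^ 2 * Real.log (2 * R) ≤
      ∑ d ∈ Finset.range (2 * R), vonMangoldt d * mulW H d := by
    have : ∑ d ∈ Finset.range (2 * R),
        ((if Odd d then (H : ℝ) ^ 2 * (vonMangoldt d / d) else 0) - R / 2 * Real.log (2 * R)) ≤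
        ∑ d ∈ Finset.range (2 * R), vonMangoldt d * mulW H d := by
      refine Finset.sum_le_sum fun d hd => ?_
      have hdR : (d : ℝ) ≤ 2 * R := by exact_mod_cast (Finset.mem_range.1 hd).le
      have hlog : 0 ≤ Real.log (2 * R) := Real.log_nonneg (by
        have : (1 : ℝ) ≤ R := by exact_mod_cast hR
        linarith)
      split_ifs with ho
      · have hd0 : (0 : ℝ) < d := by exact_mod_cast ho.pos
        have v1 : vonMangoldt d ≤ Real.log (2 * R) :=
          vonMangoldt_le_log.trans (Real.log_le_log hd0 hdR)
        have v2 := mul_le_mul_of_nonneg_left (mulW_bounds H d ho).1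
          (vonMangoldt_nonneg (n := d))
        have v3 : vonMangoldt d * (d / 4) ≤ Real.log (2 * R) * (2 * R / 4) :=
          mul_le_mul v1 (by linarith) (by positivity) hlog
        have v4 : vonMangoldt d * ((H : ℝ) ^ 2 / d) = (H : ℝ) ^ 2 * (vonMangoldt d / d) := by ring
        rw [mul_sub, v4] at v2
        linarith
      · rw [mulW_even _ _ ho]
        have : 0 ≤ R / 2 * Real.log (2 * R) := by positivity
        linarith
    rw [Finset.sum_sub_distrib, ← Finset.sum_filter, ← Finset.mul_sum, Finset.sum_const,
      Finset.card_range, nsmul_eq_mul] at this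
    refine le_trans (le_of_eq ?_) this
    push_cast; ring
  have s5 : ∑ i ∈ Finset.range H, (2 * H - (2 * i + 1) : ℝ) * Real.log (2 * i + 1) = oddLog H := rfl
  rw [s5]
  rw [← hH] at s2
  rw [hHr] at s4
  nlinarith [mul_le_mul_of_nonneg_left s3 (sq_nonneg (2 * u + 1 : ℝ))]

theorem cube_root_re (z : ℂ) (hz : z ^ 3 = 1) : z = 1 ∨ z.re = -1 / 2 := by
  have h : (z - 1) * (z * z + z + 1) = 0 := by linear_combination hz
  rcases mul_eq_zero.1 h with h | h
  · left; linear_combination h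
  right
  have hre := congrArg Complex.re h
  have him := congrArg Complex.im h
  simp at hre him
  have : z.im * (2 * z.re + 1) = 0 := by linarith
  rcases mul_eq_zero.1 this with h0 | h0
  · rw [h0] at hre
    nlinarith [sq_nonneg (2 * z.re + 1)]
  · linarith

theorem char_smooth {f : ℕ} (χ : DirichletCharacter ℂ f) (n : ℕ) (hn : n ≠ 0)
    (h : ∀ p : ℕ, p.Prime → p ∣ n → χ (p : ZMod f) = 1) : χ (n : ZMod f) = 1 := by
  induction n using induction_on_primes with
  | zero => exact absurd rfl hn
  | one => simp
  | prime_mul p a hp ih =>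
    rw [Nat.cast_mul, map_mul, h p hp (dvd_mul_right _ _),
      ih (by rintro rfl; simp at hn) (fun r hr hra => h r hr (hra.mul_left _)), one_mul]

theorem weight_nonneg {H i : ℕ} (hi : i ∈ Finset.range H) :
    (0 : ℝ) ≤ 2 * H - (2 * i + 1) := by
  have := Finset.mem_range.1 hi
  have : ((2 * i + 1 : ℕ) : ℝ) ≤ (2 * H : ℕ) := by exact_mod_cast (by omega)
  push_cast at this; linarith

theorem odd_pv_re {f : ℕ} [Fact f.Prime] (χ : DirichletCharacter ℂ f) (hχ : χ ≠ 1)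
    (hev : χ (-1) = 1) (H : ℕ) (hH : 2 * H < f) (c : ℂ) (hc : ‖c‖ ≤ 1) :
    |∑ i ∈ Finset.range H, (2 * H - (2 * i + 1) : ℝ) * (c * χ ((2 * i + 1 : ℕ) : ZMod f)).re|
      ≤ H * √f := by
  have h1 := odd_pv χ hχ hev H hH
  have e : ∑ i ∈ Finset.range H, (2 * H - (2 * i + 1) : ℝ) *
      (c * χ ((2 * i + 1 : ℕ) : ZMod f)).re =
      (c * ∑ i ∈ Finset.range H,
        ((2 * H - (2 * i + 1) : ℝ) : ℂ) * χ ((2 * i + 1 : ℕ) : ZMod f)).re := by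
    rw [Finset.mul_sum, Complex.re_sum]
    refine Finset.sum_congr rfl fun i _ => ?_
    rw [← Complex.re_ofReal_mul]
    congr 1; ring
  rw [e]
  refine (Complex.abs_re_le_norm _).trans ?_
  rw [norm_mul]
  calc _ ≤ 1 * _ := mul_le_mul_of_nonneg_right hc (norm_nonneg _)
    _ ≤ _ := by rw [one_mul]; exact h1

open Classical in
theorem case_large {f : ℕ} [Fact f.Prime] (hf14 : 10 ^ 14 ≤ f) (χ : DirichletCharacter ℂ f)
    (hχ : χ ≠ 1) (hev : χ (-1) = 1) (hcube : ∀ n : ℕ, 0 < n → n < f → χ (n : ZMod f) ^ 3 = 1)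
    (R : ℕ) (hR : R = Nat.sqrt f / 80)
    (hp1 : ∀ p : ℕ, p.Prime → 2 < p → p < 2 * R → χ (p : ZMod f) = 1) : False := by
  have hs : 10 ^ 7 ≤ Nat.sqrt f := by
    rw [Nat.le_sqrt]; exact le_trans (by norm_num) hf14
  have hR1 : 125000 ≤ R := by omega
  have hR2 : Nat.sqrt f + 1 ≤ 80 * (R + 1) := by omega
  have hsq : √(f : ℝ) ≤ 80 * (R + 1) := by
    apply Real.sqrt_le_iff.2
    refine ⟨by positivity, ?_⟩
    have h2 : f < (Nat.sqrt f + 1) ^ 2 := Nat.lt_succ_sqrt' f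
    have h3 : (Nat.sqrt f + 1) ^ 2 ≤ (80 * (R + 1)) ^ 2 := Nat.pow_le_pow_left hR2 2
    exact_mod_cast h2.le.trans h3
  have hHf : 2 * (401 * R) < f := by
    have h1 : Nat.sqrt f * Nat.sqrt f ≤ f := Nat.sqrt_le f
    have h2 : 80 * R ≤ Nat.sqrt f := by omega
    nlinarith
  set H := (2 * 200 + 1) * R with hH
  have hHf : 2 * H < f := by omega
  have hHr : (H : ℝ) = 401 * R := by rw [hH]; push_cast; ring
  have hb := rough_bound 200 R (by omega)
  rw [← hH] at hb
  set W : ℝ := ∑ i ∈ Finset.range H,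
      if (∃ p : ℕ, p.Prime ∧ p ∣ 2 * i + 1 ∧ 2 * R ≤ p) then
        (2 * H - (2 * i + 1) : ℝ) else 0 with hW
  have hRr : (125000 : ℝ) ≤ R := by exact_mod_cast hR1
  have hlogpos : 0 < Real.log (2 * R) := Real.log_pos (by linarith)
  have hlog : Real.log 401 ≤ Real.log (2 * R) / 2 := by
    have h1 : Real.log (401 ^ 2) ≤ Real.log (2 * R) :=
      Real.log_le_log (by norm_num) (by norm_num; linarith)
    rw [Real.log_pow] at h1
    push_cast at h1; linarith
  have hWle : W ≤ (401 * R) ^ 2 / 2 + R ^ 2 := by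
    have e : (2 * (200 : ℕ) + 1 : ℝ) = 401 := by norm_num
    rw [e] at hb
    have h3 : ((401 : ℝ) * R) ^ 2 * Real.log 401 ≤ (401 * R) ^ 2 * (Real.log (2 * R) / 2) :=
      mul_le_mul_of_nonneg_left hlog (by positivity)
    have h4 : Real.log (2 * R) * W ≤ Real.log (2 * R) * ((401 * R) ^ 2 / 2 + R ^ 2) := by
      linarith
    exact le_of_mul_le_mul_left h4 hlogpos
  have hpv := (abs_le.1 (odd_pv_re χ hχ hev H hHf 1 (by simp))).2
  have hsum := sum_w H
  have hpt : ∑ i ∈ Finset.range H, (2 * H - (2 * i + 1) : ℝ) *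
      (1 - (1 * χ ((2 * i + 1 : ℕ) : ZMod f)).re) ≤ 3 / 2 * W := by
    rw [hW, Finset.mul_sum]
    refine Finset.sum_le_sum fun i hi => ?_
    have hw := weight_nonneg hi
    have hi' := Finset.mem_range.1 hi
    rw [one_mul]
    split_ifs with h
    · have hre : -1 / 2 ≤ (χ ((2 * i + 1 : ℕ) : ZMod f)).re := by
        rcases cube_root_re _ (hcube (2 * i + 1) (by omega) (by omega)) with h | h
        · rw [h]; norm_num
        · rw [h]
      nlinarith
    · push Not at h
      rw [char_smooth χ (2 * i + 1) (by omega)]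
      · simp
      · intro p hp hpd
        refine hp1 p hp ?_ (h p hp hpd)
        rcases hp.two_le.lt_or_eq with h2 | h2
        · exact h2
        · rw [← h2] at hpd; omega
  simp_rw [mul_sub (_ : ℝ) (1 : ℝ), mul_one] at hpt
  rw [Finset.sum_sub_distrib, hsum] at hpt
  rw [hHr] at hpt hpv
  have hmul : (401 * R : ℝ) * √f ≤ 401 * R * (80 * (R + 1)) :=
    mul_le_mul_of_nonneg_left hsq (by positivity)
  nlinarith

theorem sum_mult_s7 (q e H : ℕ) (hq : q = 2 * e + 1) (h : ℕ → ℝ) :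
    ∑ i ∈ Finset.range (q * H), (if q ∣ 2 * i + 1 then h (2 * i + 1) else 0) =
      ∑ k ∈ Finset.range H, h (q * (2 * k + 1)) := by
  have hodd : ∀ k, q * (2 * k + 1) = 2 * (q * k + e) + 1 := by intro k; rw [hq]; ring
  have img : (Finset.range (q * H)).filter (fun i => q ∣ 2 * i + 1) =
      (Finset.range H).image (fun k => q * k + e) := by
    ext i
    simp only [Finset.mem_filter, Finset.mem_range, Finset.mem_image]
    constructor
    · rintro ⟨hi, m, hm⟩
      obtain ⟨k, hk⟩ : Odd m :=
        Odd.of_dvd_nat (⟨i, rfl⟩ : Odd (2 * i + 1)) ⟨q, by rw [hm, mul_comm]⟩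
      have := hodd k
      rw [← hk, ← hm] at this
      refine ⟨k, ?_, by omega⟩
      have h1 : q * k < q * H := by omega
      exact lt_of_mul_lt_mul_left h1 (Nat.zero_le _)
    · rintro ⟨k, hk, rfl⟩
      refine ⟨?_, 2 * k + 1, (hodd k).symm⟩
      have : q * (k + 1) ≤ q * H := Nat.mul_le_mul_left _ hk
      rw [Nat.mul_succ] at this
      omega
  rw [← Finset.sum_filter, img, Finset.sum_image]
  · exact Finset.sum_congr rfl fun k _ => by rw [hodd]
  · intro a _ b _ hab
    simp only at hab
    exact Nat.eq_of_mul_eq_mul_left (by omega : 0 < q) (by omega)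

theorem case_small {f : ℕ} [Fact f.Prime] (hf14 : 10 ^ 14 ≤ f) (χ : DirichletCharacter ℂ f)
    (hχ : χ ≠ 1) (hev : χ (-1) = 1) (hcube : ∀ n : ℕ, 0 < n → n < f → χ (n : ZMod f) ^ 3 = 1)
    (q : ℕ) (hqp : q.Prime) (hq2 : 2 < q) (hq : q < 2 * (Nat.sqrt f / 80))
    (ω : ℂ) (hω : ω ^ 3 = 1)
    (hno : ∀ m : ℕ, 0 < m → Nat.Coprime m (2 * q) → 3 * q * m ≤ f → χ (m : ZMod f) ≠ ω) :
    False := by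
  obtain ⟨e, he⟩ : Odd q := hqp.odd_of_ne_two (by omega)
  set K := f / (6 * q ^ 2) with hK
  have hKf : 6 * q ^ 2 * K ≤ f := Nat.mul_div_le _ _
  have hKl : f < 6 * q ^ 2 * (K + 1) := by
    have := Nat.lt_mul_div_succ f (by positivity : 0 < 6 * q ^ 2)
    simpa [hK] using this
  have h40 : 40 * q ≤ Nat.sqrt f := by omega
  have h40' : (40 * q : ℝ) ≤ √f := by
    apply Real.le_sqrt_of_sq_le
    have h1 : Nat.sqrt f * Nat.sqrt f ≤ f := Nat.sqrt_le f
    have h2 : (40 * q) ^ 2 ≤ f := by nlinarith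
    exact_mod_cast h2
  have hss : √(f : ℝ) * √f = f := Real.mul_self_sqrt (by positivity)
  have hqr : (3 : ℝ) ≤ q := by exact_mod_cast hq2
  have hspos : 0 < √(f : ℝ) := by linarith
  set H := q * K with hH
  have hHr : (H : ℝ) = q * K := by rw [hH]; push_cast; ring
  have hHf3 : 3 * q * (2 * H) ≤ f := by
    calc _ = 6 * q ^ 2 * K := by rw [hH]; ring
      _ ≤ f := hKf
  have hHf : 2 * H < f := by nlinarith
  have hKH : K ≤ H := by rw [hH]; exact Nat.le_mul_of_pos_left _ (by omega)
  have nω : ‖ω‖ = 1 := Complex.norm_eq_one_of_pow_eq_one hω (by norm_num)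
  have pv1 := (abs_le.1 (odd_pv_re χ hχ hev H hHf (ω ^ 2) (by simp [nω]))).1
  have pv2 := (abs_le.1 (odd_pv_re χ hχ hev K (by omega) (ω ^ 2 * χ (q : ZMod f)) (by
    rw [norm_mul, norm_pow, nω, one_pow, one_mul]
    exact DirichletCharacter.norm_le_one _ _))).2
  have sw1 := sum_w H
  have sw2 := sum_w K
  have hpt : ∑ i ∈ Finset.range H, (2 * H - (2 * i + 1) : ℝ) *
      (1 + 2 * (ω ^ 2 * χ ((2 * i + 1 : ℕ) : ZMod f)).re) ≤
      ∑ i ∈ Finset.range (q * K), (if q ∣ 2 * i + 1 then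
        (fun n : ℕ => (2 * H - n : ℝ) * (1 + 2 * (ω ^ 2 * χ (n : ZMod f)).re)) (2 * i + 1)
        else 0) := by
    rw [← hH]
    refine Finset.sum_le_sum fun i hi => ?_
    have hi' := Finset.mem_range.1 hi
    split_ifs with hd
    · push_cast; exact le_rfl
    · have hcop : Nat.Coprime (2 * i + 1) (2 * q) := by
        apply Nat.Coprime.mul_right
        · simp
        · exact ((Nat.Prime.coprime_iff_not_dvd hqp).2 hd).symm
      have hne := hno (2 * i + 1) (by omega) hcop
        (le_trans (Nat.mul_le_mul_left _ (by omega)) hHf3)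
      have hz : (ω ^ 2 * χ ((2 * i + 1 : ℕ) : ZMod f)) ^ 3 = 1 := by
        rw [mul_pow, hcube (2 * i + 1) (by omega) (by omega)]
        linear_combination (ω ^ 3 + 1) * hω
      rcases cube_root_re _ hz with h | h
      · exfalso; apply hne
        linear_combination ω * h - χ ((2 * i + 1 : ℕ) : ZMod f) * hω
      · rw [h]; norm_num
  rw [sum_mult_s7 q e K he (fun n : ℕ => (2 * H - n : ℝ) * (1 + 2 * (ω ^ 2 * χ (n : ZMod f)).re))] at hpt
  have e2 : ∑ k ∈ Finset.range K,
      (fun n : ℕ => (2 * H - n : ℝ) * (1 + 2 * (ω ^ 2 * χ (n : ZMod f)).re)) (q * (2 * k + 1)) =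
      q * (∑ k ∈ Finset.range K, (2 * K - (2 * k + 1) : ℝ) + 2 *
        ∑ k ∈ Finset.range K, (2 * K - (2 * k + 1) : ℝ) *
          (ω ^ 2 * χ (q : ZMod f) * χ ((2 * k + 1 : ℕ) : ZMod f)).re) := by
    rw [Finset.mul_sum (a := (2 : ℝ)), ← Finset.sum_add_distrib, Finset.mul_sum]
    refine Finset.sum_congr rfl fun k _ => ?_
    simp only
    rw [Nat.cast_mul q (2 * k + 1) (α := ZMod f), map_mul, ← mul_assoc, hHr]
    push_cast; ring
  have e1 : ∑ i ∈ Finset.range H, (2 * H - (2 * i + 1) : ℝ) *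
      (1 + 2 * (ω ^ 2 * χ ((2 * i + 1 : ℕ) : ZMod f)).re) =
      ∑ i ∈ Finset.range H, (2 * H - (2 * i + 1) : ℝ) + 2 *
        ∑ i ∈ Finset.range H, (2 * H - (2 * i + 1) : ℝ) *
      (ω ^ 2 * χ ((2 * i + 1 : ℕ) : ZMod f)).re := by
    rw [Finset.mul_sum, ← Finset.sum_add_distrib]
    refine Finset.sum_congr rfl fun k _ => ?_
    ring
  rw [e1, e2, sw1, sw2] at hpt
  -- H^2 - 2 H √f ≤ q (K^2 + 2 K √f)
  have f1 : (H : ℝ) ^ 2 - 2 * (H * √f) ≤ q * ((K : ℝ) ^ 2 + 2 * (K * √f)) := by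
    refine le_trans (by linarith) (hpt.trans ?_)
    apply mul_le_mul_of_nonneg_left _ (by positivity)
    linarith
  have hKpos : (0 : ℝ) < K := by
    have : 0 < K := by
      rw [hK]
      apply Nat.div_pos _ (by positivity)
      have h1 : Nat.sqrt f * Nat.sqrt f ≤ f := Nat.sqrt_le f
      nlinarith
    exact_mod_cast this
  rw [hHr] at f1
  -- q K (q - 1) ≤ 4 q √f
  have f2 : (q - 1 : ℝ) * K ≤ 4 * √f := by
    have : (q * K : ℝ) * ((q - 1 : ℝ) * K) ≤ (q * K) * (4 * √f) := by nlinarith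
    exact le_of_mul_le_mul_left this (by positivity)
  have f3 : (q : ℝ) * K ≤ 6 * √f := by nlinarith
  have f4 : (f : ℝ) < 6 * q ^ 2 * (K + 1) := by exact_mod_cast hKl
  -- f < 6 q (6 √f + q)
  have f5 : (6 * q : ℝ) * (q * K) ≤ 6 * q * (6 * √f) :=
    mul_le_mul_of_nonneg_left f3 (by positivity)
  have f6 : (40 * q : ℝ) * √f ≤ √f * √f := mul_le_mul_of_nonneg_right h40' hspos.le
  have f7 : (q : ℝ) * (40 * q) ≤ q * √f := mul_le_mul_of_nonneg_left h40' (by positivity)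
  nlinarith


/-- If `f ≥ 10¹⁴` is prime, `χ` is a cubic character mod `f`, `2` is a cubic non-residue
(so `q₁ = 2`), and `q₂` is the smallest prime greater than `2` that is a cubic non-residue,
then for every primitive cube root of unity `ω` there exists a positive integer `m` with
`gcd(m, 2q₂) = 1`, `χ(m) = ω`, and `3·q₂·m ≤ f`. -/
theorem exists_nonresidue_q1_eq_two (f : ℕ) (hf : f.Prime) (hf14 : 10 ^ 14 ≤ f)
    (χ : DirichletCharacter ℂ f) (hχ : orderOf χ = 3)
    (h2 : χ ((2 : ℕ) : ZMod f) ≠ 0 ∧ χ ((2 : ℕ) : ZMod f) ≠ 1)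
    (q₂ : ℕ) (hq₂p : q₂.Prime) (hq₂2 : 2 < q₂)
    (hq₂nr : χ (q₂ : ZMod f) ≠ 0 ∧ χ (q₂ : ZMod f) ≠ 1)
    (hq₂min : ∀ p : ℕ, p.Prime → 2 < p → p < q₂ → χ (p : ZMod f) = 0 ∨ χ (p : ZMod f) = 1)
    (ω : ℂ) (hω : ω ^ 3 = 1) (hω1 : ω ≠ 1) :
    ∃ m : ℕ, 0 < m ∧ Nat.Coprime m (2 * q₂) ∧ χ (m : ZMod f) = ω ∧ 3 * q₂ * m ≤ f := by

  have : Fact f.Prime := ⟨hf⟩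
  have h3 : χ ^ 3 = 1 := by rw [← hχ]; exact pow_orderOf_eq_one χ
  have hne : χ ≠ 1 := by
    rintro rfl
    simp at hχ
  have hc : ∀ x : ZMod f, x ≠ 0 → χ x ^ 3 = 1 := by
    intro x hx
    rw [← MulChar.pow_apply' χ (by norm_num), h3, MulChar.one_apply (isUnit_iff_ne_zero.2 hx)]
  have hn0 : ∀ n : ℕ, 0 < n → n < f → (n : ZMod f) ≠ 0 := by
    intro n h0 h1 h
    rw [ZMod.natCast_eq_zero_iff] at h
    exact absurd (Nat.le_of_dvd h0 h) (by omega)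
  have hcube : ∀ n : ℕ, 0 < n → n < f → χ (n : ZMod f) ^ 3 = 1 :=
    fun n h0 h1 => hc _ (hn0 n h0 h1)
  have hev : χ (-1) = 1 := by
    have h1 := hc (-1) (by simp)
    have h2 : χ (-1) * χ (-1) = 1 := by rw [← map_mul]; simp
    linear_combination h1 - χ (-1) * h2
  by_contra hcon
  push Not at hcon
  by_cases hq : q₂ < 2 * (Nat.sqrt f / 80)
  · refine case_small hf14 χ hne hev hcube q₂ hq₂p hq₂2 hq ω hω fun m hm hcop hle heq => ?_
    exact absurd hle (not_le.2 (hcon m hm hcop heq))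
  · refine case_large hf14 χ hne hev hcube _ rfl fun p hp h2 hlt => ?_
    rcases hq₂min p hp h2 (by omega) with h | h
    · exfalso
      have hpf : p < f := by
        have := Nat.sqrt_le_self f
        omega
      have := hcube p (by omega) hpf
      rw [h] at this
      norm_num at this
    · exact h
end

section
/- Let f be a prime and let U, V be positive integers with UV < f. Let λ be an integer with λ ≢ 0 (mod f), and let Δ ≥ 1 be a real number. Suppose the congruence v ≡ λu (mod f) has at least Δ solutions (u,v) with u, v integers, 1 ≤ u ≤ U and 1 ≤ v ≤ V. Then there exist positive integers u₀, v₀ with 1 ≤ u₀ ≤ U/Δ, 1 ≤ v₀ ≤ V/Δ, gcd(u₀, v₀) = 1, and v₀ ≡ λu₀ (mod f). -/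
open scoped Classical

/-- If the congruence `v ≡ λu (mod f)`, `1 ≤ u ≤ U`, `1 ≤ v ≤ V`, has at least `Δ` solutions
and `UV < f`, then there is a coprime solution `(u₀, v₀)` with `u₀ ≤ U/Δ` and `v₀ ≤ V/Δ`. -/
theorem exists_small_coprime_solution (f : ℕ) (hf : f.Prime) (U V : ℕ)
    (hU : 0 < U) (hV : 0 < V) (hUV : U * V < f)
    (lam : ℤ) (hlam : ¬((f : ℤ) ∣ lam)) (Δ : ℝ) (hΔ : 1 ≤ Δ)
    (hsol : Δ ≤ (((Finset.Icc 1 U ×ˢ Finset.Icc 1 V).filter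
        (fun p : ℕ × ℕ => (p.2 : ℤ) ≡ lam * (p.1 : ℤ) [ZMOD (f : ℤ)])).card : ℝ)) :
    ∃ u₀ v₀ : ℕ, 1 ≤ u₀ ∧ (u₀ : ℝ) ≤ (U : ℝ) / Δ ∧ 1 ≤ v₀ ∧ (v₀ : ℝ) ≤ (V : ℝ) / Δ ∧
      Nat.Coprime u₀ v₀ ∧ (v₀ : ℤ) ≡ lam * (u₀ : ℤ) [ZMOD (f : ℤ)] := by
  set S := (Finset.Icc 1 U ×ˢ Finset.Icc 1 V).filter
        (fun p : ℕ × ℕ => (p.2 : ℤ) ≡ lam * (p.1 : ℤ) [ZMOD (f : ℤ)]) with hS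
  have hpos : 0 < S.card := by
    have h1 : (0 : ℝ) < (S.card : ℝ) := by linarith
    exact_mod_cast h1
  obtain ⟨⟨a, b⟩, hab⟩ := Finset.card_pos.mp hpos
  have hmem : ∀ u v : ℕ, (u, v) ∈ S ↔ ((1 ≤ u ∧ u ≤ U) ∧ (1 ≤ v ∧ v ≤ V)) ∧
      (v : ℤ) ≡ lam * (u : ℤ) [ZMOD (f : ℤ)] := by
    intro u v
    simp [hS]
  obtain ⟨⟨⟨ha1, haU⟩, hb1, hbV⟩, hcong⟩ := (hmem a b).mp hab
  obtain ⟨g, u₀, v₀, hg, hcop, rfl, rfl⟩ := Nat.exists_coprime' (m := a) (n := b)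
    (Nat.gcd_pos_of_pos_left _ ha1)
  have hu0 : 0 < u₀ := Nat.pos_of_ne_zero (by rintro rfl; simp at ha1)
  have hv0 : 0 < v₀ := Nat.pos_of_ne_zero (by rintro rfl; simp at hb1)
  have hgf : g < f := by
    have h1 : g ≤ u₀ * g := Nat.le_mul_of_pos_left g hu0
    have h2 : U ≤ U * V := Nat.le_mul_of_pos_right U hV
    omega
  have hfg : IsCoprime (f : ℤ) (g : ℤ) := by
    rw [Nat.isCoprime_iff_coprime]
    exact (Nat.Prime.coprime_iff_not_dvd hf).mpr (Nat.not_dvd_of_pos_of_lt hg hgf)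
  have hcong0 : (v₀ : ℤ) ≡ lam * (u₀ : ℤ) [ZMOD (f : ℤ)] := by
    rw [Int.modEq_iff_dvd] at hcong ⊢
    have h1 : lam * ((u₀ * g : ℕ) : ℤ) - ((v₀ * g : ℕ) : ℤ) = (lam * u₀ - v₀) * g := by
      push_cast
      ring
    rw [h1] at hcong
    exact hfg.dvd_of_dvd_mul_right hcong
  have hu0U : u₀ ≤ U := (Nat.le_mul_of_pos_right u₀ hg).trans haU
  have hv0V : v₀ ≤ V := (Nat.le_mul_of_pos_right v₀ hg).trans hbV
  -- every solution is a multiple of the primitive one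
  have hmul : ∀ u v : ℕ, (u, v) ∈ S → ∃ k, 1 ≤ k ∧ u = k * u₀ ∧ v = k * v₀ := by
    intro u v huv
    obtain ⟨⟨⟨hu1, huU⟩, hv1, hvV⟩, hc⟩ := (hmem u v).mp huv
    have hmod : u * v₀ ≡ u₀ * v [MOD f] := by
      rw [← Int.natCast_modEq_iff]
      push_cast
      have h1 := hcong0.mul_left (u : ℤ)
      have h2 := hc.mul_left (u₀ : ℤ)
      refine h1.trans (Int.ModEq.trans ?_ h2.symm)
      rw [show (u : ℤ) * (lam * u₀) = u₀ * (lam * u) by ring]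
    have heq : u * v₀ = u₀ * v :=
      hmod.eq_of_lt_of_lt ((Nat.mul_le_mul huU hv0V).trans_lt hUV)
        ((Nat.mul_le_mul hu0U hvV).trans_lt hUV)
    have hd : u₀ ∣ u := hcop.dvd_of_dvd_mul_right ⟨v, heq⟩
    obtain ⟨k, rfl⟩ := hd
    refine ⟨k, Nat.pos_of_ne_zero (by rintro rfl; simp at hu1), Nat.mul_comm _ _, ?_⟩
    rw [Nat.mul_assoc] at heq
    exact (Nat.eq_of_mul_eq_mul_left hu0 heq).symm
  have hcard : ∀ m : ℕ, (∀ k, (k * u₀, k * v₀) ∈ S → k ≤ m) → S.card ≤ m := by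
    intro m hm
    have hsub : S ⊆ (Finset.Icc 1 m).image (fun k => (k * u₀, k * v₀)) := by
      rintro ⟨u, v⟩ huv
      obtain ⟨k, hk, rfl, rfl⟩ := hmul u v huv
      exact Finset.mem_image.mpr ⟨k, Finset.mem_Icc.mpr ⟨hk, hm k huv⟩, rfl⟩
    have h1 := (Finset.card_le_card hsub).trans Finset.card_image_le
    simpa using h1
  have hA : S.card ≤ U / u₀ := hcard _ fun k hk =>
    (Nat.le_div_iff_mul_le hu0).mpr ((hmem _ _).mp hk).1.1.2
  have hB : S.card ≤ V / v₀ := hcard _ fun k hk =>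
    (Nat.le_div_iff_mul_le hv0).mpr ((hmem _ _).mp hk).1.2.2
  rw [Nat.le_div_iff_mul_le hu0] at hA
  rw [Nat.le_div_iff_mul_le hv0] at hB
  have hA' : (S.card : ℝ) * u₀ ≤ U := by exact_mod_cast hA
  have hB' : (S.card : ℝ) * v₀ ≤ V := by exact_mod_cast hB
  have hΔ0 : 0 < Δ := by linarith
  refine ⟨u₀, v₀, hu0, ?_, hv0, ?_, hcop, hcong0⟩
  · rw [le_div_iff₀ hΔ0, mul_comm]
    exact (mul_le_mul_of_nonneg_right hsol (Nat.cast_nonneg _)).trans hA'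
  · rw [le_div_iff₀ hΔ0, mul_comm]
    exact (mul_le_mul_of_nonneg_right hsol (Nat.cast_nonneg _)).trans hB'
end

section
/- For any positive integers U and V, the number of pairs (u,v) of integers with 1 ≤ u ≤ U, 1 ≤ v ≤ V and gcd(u,v) = 1 is at most (6/π²)·UV + (6/π²)·(U+V)·log U + 2.044·V + 1.652·U + 2.04·V/√U + 2.72·√U. -/
open ArithmeticFunction in
lemma aux_indicator (U n : ℕ) (hn : 0 < n) (h : n ≤ U) :
    ∑ d ∈ Finset.Ioc 0 U, (if d ∣ n then (moebius d : ℝ) else 0) = if n = 1 then 1 else 0 := by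
  rw [← Finset.sum_filter]
  have h1 : (Finset.Ioc 0 U).filter (fun d => d ∣ n) = n.divisors := by
    ext d
    simp only [Finset.mem_filter, Finset.mem_Ioc, Nat.mem_divisors]
    constructor
    · rintro ⟨_, h2⟩
      exact ⟨h2, hn.ne'⟩
    · rintro ⟨h2, _⟩
      exact ⟨⟨Nat.pos_of_dvd_of_pos h2 hn, (Nat.le_of_dvd hn h2).trans h⟩, h2⟩
  rw [h1]
  have h2 := congrArg (fun f : ArithmeticFunction ℤ => f n) moebius_mul_coe_zeta
  simp only [coe_mul_zeta_apply, one_apply] at h2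
  exact_mod_cast h2

open ArithmeticFunction in
lemma aux_sum_floor (U : ℕ) (hU : 0 < U) :
    ∑ d ∈ Finset.Ioc 0 U, (moebius d : ℝ) * ((U / d : ℕ) : ℝ) = 1 := by
  have h1 : ∀ d, ((U / d : ℕ) : ℝ) = ∑ n ∈ Finset.Ioc 0 U, if d ∣ n then (1 : ℝ) else 0 := by
    intro d
    rw [← Nat.Ioc_filter_dvd_card_eq_div, Finset.card_filter]
    push_cast
    rfl
  simp_rw [h1, Finset.mul_sum, mul_ite, mul_one, mul_zero]
  rw [Finset.sum_comm]
  rw [Finset.sum_congr rfl (fun n hn => aux_indicator U n (Finset.mem_Ioc.1 hn).1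
    (Finset.mem_Ioc.1 hn).2)]
  rw [Finset.sum_ite_eq' (Finset.Ioc 0 U) 1 (fun _ => (1 : ℝ))]
  simp
  omega

open ArithmeticFunction in
lemma aux_count (U V : ℕ) :
    ((((Finset.Icc 1 U) ×ˢ (Finset.Icc 1 V)).filter
        (fun p : ℕ × ℕ => Nat.Coprime p.1 p.2)).card : ℝ) =
    ∑ d ∈ Finset.Ioc 0 U, (moebius d : ℝ) * (((U / d : ℕ) : ℝ) * ((V / d : ℕ) : ℝ)) := by
  have h1 : ∀ W d : ℕ, ((W / d : ℕ) : ℝ) = ∑ n ∈ Finset.Ioc 0 W, if d ∣ n then (1 : ℝ) else 0 := by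
    intro W d
    rw [← Nat.Ioc_filter_dvd_card_eq_div, Finset.card_filter]
    push_cast
    rfl
  have e : ∀ W : ℕ, Finset.Icc 1 W = Finset.Ioc 0 W := by
    intro W; ext; simp; omega
  rw [e, e, Finset.card_filter, Finset.sum_product]
  push_cast
  simp_rw [h1, Finset.sum_mul_sum, Finset.mul_sum]
  symm
  rw [Finset.sum_comm]
  refine Finset.sum_congr rfl fun u hu => ?_
  rw [Finset.sum_comm]
  refine Finset.sum_congr rfl fun v hv => ?_
  rw [Finset.mem_Ioc] at hu hv
  have := aux_indicator U (Nat.gcd u v) (Nat.gcd_pos_of_pos_left _ hu.1)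
    ((Nat.gcd_le_left _ hu.1).trans hu.2)
  unfold Nat.Coprime
  rw [← this]
  refine Finset.sum_congr rfl fun d _ => ?_
  simp only [Nat.dvd_gcd_iff]
  by_cases h : d ∣ u <;> by_cases h' : d ∣ v <;> simp [h, h']

open ArithmeticFunction in
lemma aux_moebius_real (d : ℕ) :
    (moebius d : ℝ) = 0 ∨ (moebius d : ℝ) = 1 ∨ (moebius d : ℝ) = -1 := by
  rcases moebius_eq_or d with h | h | h <;> simp [h]

lemma aux_floor (U d : ℕ) (hd : 0 < d) :
    ((U / d : ℕ) : ℝ) ≤ U / d ∧ (U : ℝ) / d - 1 ≤ ((U / d : ℕ) : ℝ) := by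
  refine ⟨Nat.cast_div_le, ?_⟩
  have hd' : (0 : ℝ) < d := by exact_mod_cast hd
  rw [sub_le_iff_le_add, div_le_iff₀ hd']
  have : U ≤ (U / d + 1) * d := by
    have := Nat.div_add_mod U d
    have := Nat.mod_lt U hd
    nlinarith
  exact_mod_cast this

open ArithmeticFunction in
lemma aux_sum_div (U : ℕ) (hU : 0 < U) :
    -1 ≤ ∑ d ∈ Finset.Ioc 0 U, (moebius d : ℝ) / d := by
  have hU' : (0 : ℝ) < U := by exact_mod_cast hU
  have h : ∀ d ∈ Finset.Ioc 0 U, (moebius d : ℝ) * ((U / d : ℕ) : ℝ) - 1 ≤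
      U * ((moebius d : ℝ) / d) := by
    intro d hd
    obtain ⟨h1, h2⟩ := aux_floor U d (Finset.mem_Ioc.1 hd).1
    have e : (U : ℝ) * ((moebius d : ℝ) / d) = moebius d * (U / d) := by ring
    rw [e]
    rcases aux_moebius_real d with h | h | h <;> rw [h] <;> linarith
  have := Finset.sum_le_sum h
  rw [Finset.sum_sub_distrib, aux_sum_floor U hU, ← Finset.mul_sum] at this
  simp at this
  by_contra hc
  push Not at hc
  nlinarith

open ArithmeticFunction in
lemma aux_hasSum : HasSum (fun d : ℕ => (moebius d : ℝ) / (d : ℝ) ^ 2) (6 / Real.pi ^ 2) := by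
  have h2 : 1 < (2 : ℂ).re := by norm_num
  have hs := (LSeriesSummable_moebius_iff.mpr h2).hasSum
  have hL : LSeries (fun n => ((moebius n : ℤ) : ℂ)) 2 = ((6 / Real.pi ^ 2 : ℝ) : ℂ) := by
    have h := LSeries_one_mul_Lseries_moebius h2
    rw [LSeries_one_eq_riemannZeta h2, riemannZeta_two] at h
    have hp : (Real.pi : ℂ) ≠ 0 := by exact_mod_cast Real.pi_ne_zero
    push_cast
    field_simp at h ⊢
    linear_combination h
  rw [LSeries] at hL
  rw [hL] at hs
  rw [← Complex.hasSum_ofReal]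
  convert hs using 1
  ext d
  rcases Nat.eq_zero_or_pos d with rfl | hd
  · simp
  · rw [LSeries.term_of_ne_zero hd.ne']
    push_cast
    norm_cast

open ArithmeticFunction in
lemma aux_partial (U : ℕ) (hU : 0 < U) :
    ∑ d ∈ Finset.Ioc 0 U, (moebius d : ℝ) / (d : ℝ) ^ 2 ≤ 6 / Real.pi ^ 2 + 1 / U := by
  have ht := aux_hasSum.tendsto_sum_nat
  have ht' := ((Filter.tendsto_add_atTop_iff_nat 1).2 ht).add_const (1 / (U : ℝ))
  refine ge_of_tendsto ht' ?_
  filter_upwards [Filter.eventually_ge_atTop U] with n hn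
  have e : Finset.range (n + 1) = insert 0 (Finset.Ioc 0 U ∪ Finset.Ioc U n) := by
    ext; simp; omega
  rw [e, Finset.sum_insert (by simp), Finset.sum_union (by
    rw [Finset.disjoint_left]; intro a; simp; omega)]
  have h1 := sum_Ioc_inv_sq_le_sub (α := ℝ) hU.ne' hn
  have h2 : -∑ d ∈ Finset.Ioc U n, ((d : ℝ) ^ 2)⁻¹ ≤
      ∑ d ∈ Finset.Ioc U n, (moebius d : ℝ) / (d : ℝ) ^ 2 := by
    rw [← Finset.sum_neg_distrib]
    refine Finset.sum_le_sum fun d _ => ?_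
    have : 0 ≤ ((d : ℝ) ^ 2)⁻¹ := by positivity
    rw [div_eq_mul_inv]
    rcases aux_moebius_real d with h | h | h <;> rw [h] <;> linarith
  have h3 : (0 : ℝ) ≤ (n : ℝ)⁻¹ := by positivity
  rw [one_div]
  simp only [Nat.cast_zero, ne_eq, OfNat.ofNat_ne_zero, not_false_eq_true, zero_pow, div_zero]
  linarith

/-- The number of coprime pairs `(u,v) ∈ [1,U] × [1,V]` is at most
`(6/π²)UV + (6/π²)(U+V)log U + 2.044V + 1.652U + 2.04V/√U + 2.72√U`. -/
theorem coprime_pairs_count_bound (U V : ℕ) (hU : 0 < U) (hV : 0 < V) :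
    ((((Finset.Icc 1 U) ×ˢ (Finset.Icc 1 V)).filter
        (fun p : ℕ × ℕ => Nat.Coprime p.1 p.2)).card : ℝ) ≤
      6 / Real.pi ^ 2 * U * V + 6 / Real.pi ^ 2 * ((U : ℝ) + V) * Real.log U +
        2.044 * V + 1.652 * U + 2.04 * V / Real.sqrt U + 2.72 * Real.sqrt U := by
  have hU' : (0 : ℝ) < U := by exact_mod_cast hU
  have hV' : (0 : ℝ) < V := by exact_mod_cast hV
  rw [aux_count]
  have key : ∀ d ∈ Finset.Ioc 0 U,
      (ArithmeticFunction.moebius d : ℝ) * (((U / d : ℕ) : ℝ) * ((V / d : ℕ) : ℝ)) ≤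
      (U * V : ℝ) * ((ArithmeticFunction.moebius d : ℝ) / (d : ℝ) ^ 2) +
      ((U + V : ℝ) / 2) * ((d : ℝ)⁻¹ - (ArithmeticFunction.moebius d : ℝ) / d) := by
    intro d hd
    have hd0 := (Finset.mem_Ioc.1 hd).1
    have hd' : (0 : ℝ) < d := by exact_mod_cast hd0
    obtain ⟨h1, h2⟩ := aux_floor U d hd0
    obtain ⟨h3, h4⟩ := aux_floor V d hd0
    have h5 : (0 : ℝ) ≤ ((U / d : ℕ) : ℝ) := Nat.cast_nonneg _
    have h6 : (0 : ℝ) ≤ ((V / d : ℕ) : ℝ) := Nat.cast_nonneg _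
    have e : (U * V : ℝ) * ((ArithmeticFunction.moebius d : ℝ) / (d : ℝ) ^ 2) +
      ((U + V : ℝ) / 2) * ((d : ℝ)⁻¹ - (ArithmeticFunction.moebius d : ℝ) / d) =
      (ArithmeticFunction.moebius d : ℝ) * ((U / d : ℝ) * (V / d : ℝ)) +
      ((U / d : ℝ) + (V / d : ℝ)) / 2 * (1 - ArithmeticFunction.moebius d) := by
      field_simp
    rw [e]
    generalize ((U / d : ℕ) : ℝ) = fa at *
    generalize ((V / d : ℕ) : ℝ) = fb at *
    generalize (U / d : ℝ) = a at *
    generalize (V / d : ℝ) = b at *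
    rcases aux_moebius_real d with h | h | h <;> rw [h]
    · linarith
    · nlinarith [mul_le_mul h1 h3 h6 (h5.trans h1)]
    · nlinarith [mul_nonneg (sub_nonneg.2 h2) (h6.trans h3),
        mul_nonneg h5 (sub_nonneg.2 h4)]
  refine (Finset.sum_le_sum key).trans ?_
  rw [Finset.sum_add_distrib, ← Finset.mul_sum, ← Finset.mul_sum, Finset.sum_sub_distrib]
  have hA := aux_partial U hU
  have hB := aux_sum_div U hU
  have hH : ∑ d ∈ Finset.Ioc 0 U, (d : ℝ)⁻¹ ≤ 1 + Real.log U := by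
    have := harmonic_le_one_add_log U
    rw [harmonic_eq_sum_Icc] at this
    push_cast at this
    exact this
  have hlog : 0 ≤ Real.log U := Real.log_natCast_nonneg U
  have hpi : 1 / 2 ≤ 6 / Real.pi ^ 2 := by
    rw [div_le_div_iff₀ (by norm_num) (by positivity)]
    nlinarith [Real.pi_lt_d2, Real.pi_pos]
  have hs1 : 0 ≤ 2.04 * (V : ℝ) / Real.sqrt U := by positivity
  have hs2 : 0 ≤ 2.72 * Real.sqrt U := by positivity
  have t1 := mul_le_mul_of_nonneg_left hA (mul_pos hU' hV').le
  have e1 : (U * V : ℝ) * (6 / Real.pi ^ 2 + 1 / U) = 6 / Real.pi ^ 2 * U * V + V := by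
    field_simp
  rw [e1] at t1
  have t3 := mul_le_mul_of_nonneg_right hpi (show 0 ≤ (U + V : ℝ) * Real.log U by positivity)
  have t2 : (U + V : ℝ) / 2 * (∑ d ∈ Finset.Ioc 0 U, (d : ℝ)⁻¹ -
      ∑ d ∈ Finset.Ioc 0 U, (ArithmeticFunction.moebius d : ℝ) / d) ≤
      (U + V : ℝ) / 2 * (2 + Real.log U) :=
    mul_le_mul_of_nonneg_left (by linarith) (by positivity)
  linarith
end
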